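/- arXiv:2310.11704 — 3 statements merged into one kernel-verified Lean document; each statement's English description precedes it below -/
import Mathlib

section
/- Let G be a bicyclic graph of order m (a connected graph with m vertices and m + 1 edges) and let H be a connected simple graph of order n. Then p(G □ H) ≤ mn/2. -/
open SimpleGraph

/-- `P` is a path decomposition of `G`: a list of edge-disjoint paths of `G`
covering all the edges of `G`. -/
def SimpleGraph.IsPathDecomp {V : Type*} (G : SimpleGraph V)
    (P : List (Σ u v : V, G.Walk u v)) : Prop :=
  (∀ p ∈ P, p.2.2.IsPath) ∧
  P.Pairwise (fun p q => ∀ e ∈ p.2.2.edges, e ∉ q.2.2.edges) ∧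
  ∀ e ∈ G.edgeSet, ∃ p ∈ P, e ∈ p.2.2.edges

/-- `p(G)`: the minimum number of paths in a path decomposition of `G`. -/
noncomputable def SimpleGraph.pathNumber {V : Type*} (G : SimpleGraph V) : ℕ :=
  sInf {k | ∃ P, G.IsPathDecomp P ∧ P.length = k}

/-- The edges joining consecutive entries of a list of vertices. -/
def List.stepEdges {X : Type*} : List X → List (Sym2 X)
  | [] => []
  | [_] => []
  | a :: b :: l => s(a, b) :: List.stepEdges (b :: l)

/-- The multiset consisting of the first and the last entry of a list. -/
def List.endpoints {X : Type*} (l : List X) : Multiset X :=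
  (l.head?.toList : Multiset X) + (l.getLast?.toList : Multiset X)

namespace List

variable {X : Type*}

@[simp] lemma stepEdges_nil : stepEdges ([] : List X) = [] := rfl

@[simp] lemma stepEdges_singleton (a : X) : stepEdges [a] = [] := rfl

@[simp] lemma stepEdges_cons_cons (a b : X) (l : List X) :
    stepEdges (a :: b :: l) = s(a, b) :: stepEdges (b :: l) := rfl

lemma stepEdges_append_cons (A B : List X) (a : X) :
    stepEdges (A ++ a :: B) = stepEdges (A ++ [a]) ++ stepEdges (a :: B) := by
  induction A with
  | nil => simp
  | cons x A ih => cases A <;> simp_all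

lemma coe_stepEdges_reverse (l : List X) :
    (stepEdges l.reverse : Multiset (Sym2 X)) = stepEdges l := by
  induction l with
  | nil => simp
  | cons x l ih =>
    cases l with
    | nil => simp
    | cons y l =>
      have h : stepEdges (x :: y :: l).reverse
          = stepEdges (y :: l).reverse ++ [s(y, x)] := by
        simp only [reverse_cons, append_assoc, singleton_append]
        rw [stepEdges_append_cons]
        simp
      rw [h, ← Multiset.coe_add, ih, stepEdges_cons_cons, ← Multiset.cons_coe, add_comm,
        Sym2.eq_swap]
      rfl

lemma mem_of_mem_stepEdges {l : List X} {e : Sym2 X} (he : e ∈ stepEdges l) {v : X}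
    (hv : v ∈ e) : v ∈ l := by
  induction l with
  | nil => simp at he
  | cons x l ih =>
    cases l with
    | nil => simp at he
    | cons y l =>
      rw [stepEdges_cons_cons, mem_cons] at he
      rcases he with rfl | he
      · rw [Sym2.mem_iff] at hv
        rcases hv with rfl | rfl <;> simp
      · exact mem_cons_of_mem _ (ih he)

lemma mk_mem_stepEdges_append (A B : List X) (a b : X) :
    s(a, b) ∈ stepEdges (A ++ a :: b :: B) := by
  rw [stepEdges_append_cons]
  simp

lemma exists_append_of_mem_stepEdges {l : List X} {x y : X} (h : s(x, y) ∈ stepEdges l) :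
    ∃ A B, l = A ++ x :: y :: B ∨ l = A ++ y :: x :: B := by
  induction l with
  | nil => simp at h
  | cons u l ih =>
    cases l with
    | nil => simp at h
    | cons v l =>
      rw [stepEdges_cons_cons, mem_cons] at h
      rcases h with h | h
      · rw [Sym2.eq_iff] at h
        rcases h with ⟨rfl, rfl⟩ | ⟨rfl, rfl⟩
        · exact ⟨[], l, .inl rfl⟩
        · exact ⟨[], l, .inr rfl⟩
      · obtain ⟨A, B, h | h⟩ := ih h
        · exact ⟨u :: A, B, .inl (by rw [h]; rfl)⟩
        · exact ⟨u :: A, B, .inr (by rw [h]; rfl)⟩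

lemma exists_mem_stepEdges {l : List X} {v : X} (hv : v ∈ l) (hl : l ≠ [v]) :
    ∃ e ∈ stepEdges l, v ∈ e := by
  induction l with
  | nil => simp at hv
  | cons x l ih =>
    cases l with
    | nil => simp_all
    | cons y l =>
      rw [mem_cons] at hv
      rcases hv with rfl | hv
      · exact ⟨s(v, y), by simp, by simp⟩
      · by_cases h : y :: l = [v]
        · rw [cons.injEq] at h
          obtain ⟨rfl, rfl⟩ := h
          exact ⟨s(x, y), by simp, by simp⟩
        · obtain ⟨e, he, hve⟩ := ih hv h
          exact ⟨e, by simp [he], hve⟩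

lemma nodup_stepEdges {l : List X} (h : l.Nodup) : l.stepEdges.Nodup := by
  induction l with
  | nil => simp
  | cons x l ih =>
    cases l with
    | nil => simp
    | cons y l =>
      rw [nodup_cons] at h
      rw [stepEdges_cons_cons, nodup_cons]
      exact ⟨fun he => h.1 (mem_of_mem_stepEdges he (by simp)), ih h.2⟩

lemma endpoints_reverse (l : List X) : endpoints l.reverse = endpoints l := by
  rw [endpoints, endpoints, head?_reverse, getLast?_reverse, add_comm]

lemma endpoints_cons (a : X) (l : List X) :
    endpoints (a :: l) = a ::ₘ {(a :: l).getLast (by simp)} := by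
  rw [endpoints, head?_cons, getLast?_eq_getLast_of_ne_nil (by simp)]
  rfl

@[simp] lemma card_endpoints {l : List X} (hl : l ≠ []) : Multiset.card l.endpoints = 2 := by
  cases l with
  | nil => simp at hl
  | cons a l => simp [endpoints_cons]

lemma mem_endpoints_iff {l : List X} {v : X} :
    v ∈ endpoints l ↔ l.head? = some v ∨ l.reverse.head? = some v := by
  simp [endpoints]

end List

/-- `P` is a collection of paths with edge multiset `E` and multiset of endpoints `D`. -/
def IsPathSystem {X : Type*} (P : Multiset (List X)) (E : Multiset (Sym2 X)) (D : Multiset X) :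
    Prop :=
  (∀ l ∈ P, l ≠ [] ∧ l.Nodup) ∧
    P.bind (fun l => (l.stepEdges : Multiset (Sym2 X))) = E ∧ P.bind List.endpoints = D

/-- `E` can be partitioned into paths (possibly trivial) whose multiset of endpoints is `D`. -/
def PathPartition {X : Type*} (E : Multiset (Sym2 X)) (D : Multiset X) : Prop :=
  ∃ P, IsPathSystem P E D

section PathPartition

variable {X : Type*} {P : Multiset (List X)} {E E₁ E₂ : Multiset (Sym2 X)} {D D₁ D₂ : Multiset X}

lemma isPathSystem_cons {l : List X} :
    IsPathSystem (l ::ₘ P) E D ↔ l ≠ [] ∧ l.Nodup ∧ ∃ E' D', IsPathSystem P E' D' ∧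
      E = l.stepEdges + E' ∧ D = l.endpoints + D' := by
  constructor
  · rintro ⟨h, rfl, rfl⟩
    refine ⟨(h l (by simp)).1, (h l (by simp)).2, _, _,
      ⟨fun k hk => h k (by simp [hk]), rfl, rfl⟩, by simp, by simp⟩
  · rintro ⟨h1, h2, E', D', ⟨h, rfl, rfl⟩, rfl, rfl⟩
    refine ⟨fun k hk => ?_, by simp, by simp⟩
    rw [Multiset.mem_cons] at hk
    rcases hk with rfl | hk
    exacts [⟨h1, h2⟩, h k hk]

lemma IsPathSystem.exists_cons {l : List X} (h : IsPathSystem P E D)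
    (hl : l ∈ P ∨ l.reverse ∈ P) : ∃ P', IsPathSystem (l ::ₘ P') E D ∧
      ∀ k, (k ∈ P ∨ k.reverse ∈ P) → (k = l ∨ k.reverse = l) ∨ (k ∈ P' ∨ k.reverse ∈ P') := by
  rcases hl with hl | hl
  · obtain ⟨P', rfl⟩ := Multiset.exists_cons_of_mem hl
    refine ⟨P', h, fun k hk => ?_⟩
    simp only [Multiset.mem_cons] at hk
    tauto
  · obtain ⟨P', rfl⟩ := Multiset.exists_cons_of_mem hl
    rw [isPathSystem_cons] at h
    refine ⟨P', ?_, fun k hk => ?_⟩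
    · rw [isPathSystem_cons]
      simpa [List.coe_stepEdges_reverse, List.endpoints_reverse] using h
    · simp only [Multiset.mem_cons, List.reverse_inj] at hk
      rcases hk with (rfl | hk) | (rfl | hk)
      · simp
      · tauto
      · tauto
      · tauto

lemma PathPartition.add (h₁ : PathPartition E₁ D₁) (h₂ : PathPartition E₂ D₂) :
    PathPartition (E₁ + E₂) (D₁ + D₂) := by
  obtain ⟨P, hP, rfl, rfl⟩ := h₁
  obtain ⟨Q, hQ, rfl, rfl⟩ := h₂
  refine ⟨P + Q, fun l hl => ?_, by simp, by simp⟩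
  rw [Multiset.mem_add] at hl
  exact hl.elim (hP l) (hQ l)

lemma pathPartition_zero (S : Multiset X) : PathPartition 0 (2 • S) := by
  refine ⟨S.map fun v => [v], by simp, ?_, ?_⟩
  · simp [Multiset.bind_map]
  · rw [Multiset.bind_map, two_nsmul]
    have h : ∀ v : X, List.endpoints [v] = {v} + {v} := fun v => rfl
    have h' : S.bind (fun v => ({v} : Multiset X)) = S := by
      rw [Multiset.bind_singleton, Multiset.map_id']
    simp only [h, Multiset.bind_add, h']

/-- Some path of `P` starts, up to reversal, at `u` and either misses `c` or enters `c` from a vertex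
of `U`. -/
def HasSlot (P : Multiset (List X)) (c : X) (U : Finset X) (u : X) : Prop :=
  ∃ l : List X, (l ∈ P ∨ l.reverse ∈ P) ∧ l.head? = some u ∧
    (c ∉ l ∨ ∃ A a B, l = A ++ a :: c :: B ∧ a ∈ U)

lemma pathPartition_switch_aux [DecidableEq X] (c : X) (U : Finset X) (z : X)
    (hz : z ∉ U) (hcU : c ∉ U) (hzc : z ≠ c) (hP : IsPathSystem P E (z ::ₘ D))
    (hE : (s(c, z) ::ₘ E).Nodup) (hU : ∀ u ∈ insert z U, HasSlot P c U u) :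
    PathPartition (s(c, z) ::ₘ E) (c ::ₘ D) := by
  induction U using Finset.strongInduction generalizing z P E with
  | H U ih =>
  obtain ⟨l, hl, hlz, hc⟩ := hU z (by simp)
  obtain ⟨P, hP, hslot⟩ := hP.exists_cons hl
  rw [isPathSystem_cons] at hP
  obtain ⟨-, hnd, E', D', hP', rfl, hD⟩ := hP
  obtain ⟨t, rfl⟩ : ∃ t, l = z :: t := by
    cases l with
    | nil => simp at hlz
    | cons a t => simp at hlz; exact ⟨t, by rw [hlz]⟩
  rw [List.endpoints_cons, Multiset.cons_add, Multiset.cons_inj_right] at hD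
  subst hD
  rcases hc with hc | ⟨A, a, B, hA, haU⟩
  · refine ⟨(c :: z :: t) ::ₘ P, ?_⟩
    rw [isPathSystem_cons]
    refine ⟨by simp, List.nodup_cons.2 ⟨hc, hnd⟩, E', D', hP', ?_, ?_⟩
    · rw [List.stepEdges_cons_cons, ← Multiset.cons_coe, Multiset.cons_add]
    · rw [List.endpoints_cons, Multiset.cons_add]
      simp
  have haz : a ≠ z := fun h => hz (h ▸ haU)
  obtain ⟨A, rfl⟩ : ∃ A', A = z :: A' := by
    cases A with
    | nil => simp at hA; exact absurd hA.1.symm haz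
    | cons b A => simp at hA; exact ⟨A, by rw [hA.1]⟩
  obtain rfl : t = A ++ a :: c :: B := by simpa using hA
  have hac : a ≠ c := fun h => hcU (h ▸ haU)
  set l' : List X := a :: (A.reverse ++ z :: c :: B) with hl'
  have hl'' : l' = (z :: A ++ [a]).reverse ++ c :: B := by simp [hl']
  have hperm : s(c, a) ::ₘ (l'.stepEdges : Multiset (Sym2 X))
      = s(c, z) ::ₘ ((z :: (A ++ a :: c :: B)).stepEdges : Multiset (Sym2 X)) := by
    have h1 : (l'.stepEdges : Multiset (Sym2 X))
        = ((z :: A ++ [a]).stepEdges : Multiset (Sym2 X)) + s(c, z) ::ₘ (c :: B).stepEdges := by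
      have : l' = (a :: A.reverse) ++ z :: c :: B := rfl
      rw [this, List.stepEdges_append_cons, ← Multiset.coe_add, List.stepEdges_cons_cons,
        ← Multiset.cons_coe, ← List.coe_stepEdges_reverse, Sym2.eq_swap]
      simp
    have h2 : ((z :: (A ++ a :: c :: B)).stepEdges : Multiset (Sym2 X))
        = ((z :: A ++ [a]).stepEdges : Multiset (Sym2 X)) + s(c, a) ::ₘ (c :: B).stepEdges := by
      have : z :: (A ++ a :: c :: B) = z :: A ++ a :: c :: B := rfl
      rw [this, List.stepEdges_append_cons, ← Multiset.coe_add, List.stepEdges_cons_cons,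
        ← Multiset.cons_coe, Sym2.eq_swap]
    rw [h1, h2, Multiset.add_cons, Multiset.add_cons, Multiset.cons_swap]
  have hE2 : s(c, z) ::ₘ ((z :: (A ++ a :: c :: B)).stepEdges + E')
      = s(c, a) ::ₘ ((l'.stepEdges : Multiset (Sym2 X)) + E') := by
    rw [← Multiset.cons_add, ← hperm, Multiset.cons_add]
  rw [hE2] at hE ⊢
  have hnd' : l'.Nodup := by
    have : l'.Perm (z :: (A ++ a :: c :: B)) := by
      rw [hl'']
      exact ((List.reverse_perm _).append_right _).trans (by simp)
    exact this.nodup_iff.2 hnd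
  have hsys : IsPathSystem (l' ::ₘ P) (l'.stepEdges + E')
      (a ::ₘ ({(z :: (A ++ a :: c :: B)).getLast (by simp)} + D')) := by
    rw [isPathSystem_cons]
    refine ⟨by simp [hl'], hnd', E', D', hP', rfl, ?_⟩
    rw [List.endpoints_cons, Multiset.cons_add]
    congr 3
    have h1 : l'.getLast? = (z :: (A ++ a :: c :: B)).getLast? := by
      have h2 : z :: (A ++ a :: c :: B) = (z :: A ++ [a]) ++ c :: B := by simp
      rw [hl'', h2, List.getLast?_append_cons, List.getLast?_append_cons]
    rw [List.getLast?_eq_getLast_of_ne_nil (by simp),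
      List.getLast?_eq_getLast_of_ne_nil (by simp)] at h1
    exact (Option.some_inj.1 h1).symm
  refine ih (U.erase a) (Finset.erase_ssubset haU) a (by simp) (by simp [hcU]) hac hsys hE ?_
  intro u hu
  rw [Finset.insert_erase haU] at hu
  obtain ⟨k, hk, hku, hkc⟩ := hU u (by simp [hu])
  have huz : u ≠ z := fun h => hz (h ▸ hu)
  rcases hslot k hk with (rfl | hkl) | hk'
  · simp at hku
    exact absurd hku.symm huz
  · obtain rfl : k = (z :: (A ++ a :: c :: B)).reverse := by rw [← hkl, List.reverse_reverse]
    refine ⟨l'.reverse, by simp, ?_, .inr ?_⟩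
    · simpa [hl', List.head?_append] using hku
    · rcases hkc with hkc | ⟨A₁, a₁, B₁, hk₁, ha₁⟩
      · simp at hkc
      have h1 : B.reverse ++ c :: (a :: (A.reverse ++ [z])) = (A₁ ++ [a₁]) ++ c :: B₁ := by
        simpa using hk₁
      have hnd1 : (B.reverse ++ c :: (a :: (A.reverse ++ [z]))).Nodup := by
        have := List.nodup_reverse.2 hnd
        rwa [hk₁, List.append_cons, ← h1] at this
      rw [List.append_cons_inj_of_notMem] at h1
      · refine ⟨A₁, a₁, z :: (A ++ [a]), by simp [hl', h1.1], Finset.mem_erase.2 ⟨?_, ha₁⟩⟩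
        rintro rfl
        have : a₁ ∈ B.reverse := by rw [h1.1]; simp
        rw [List.nodup_append] at hnd1
        exact hnd1.2.2 a₁ this a₁ (by simp) rfl
      · exact fun h => (List.nodup_cons.1 (List.nodup_middle.1 hnd1)).1
          (List.mem_append_left _ h)
      · exact fun h => (List.nodup_cons.1 (List.nodup_middle.1 hnd1)).1
          (List.mem_append_right _ h)
  · refine ⟨k, by simp only [Multiset.mem_cons]; tauto, hku, ?_⟩
    refine hkc.imp_right ?_
    rintro ⟨A₁, a₁, B₁, rfl, ha₁⟩
    refine ⟨A₁, a₁, B₁, rfl, Finset.mem_erase.2 ⟨?_, ha₁⟩⟩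
    rintro rfl
    have h1 : s(c, a₁) ∈ E' := by
      rw [← hP'.2.1, Multiset.mem_bind, Sym2.eq_swap]
      rcases hk' with hk' | hk'
      · exact ⟨_, hk', List.mk_mem_stepEdges_append _ _ _ _⟩
      · refine ⟨_, hk', ?_⟩
        rw [List.coe_stepEdges_reverse]
        exact List.mk_mem_stepEdges_append _ _ _ _
    exact (Multiset.nodup_cons.1 hE).1 (by simp [h1])

/-- An edge from `c` to an endpoint `z` can be added, moving the endpoint from `z` to `c`, as soon
as all neighbours of `c` are endpoints. -/
lemma PathPartition.switch {c z : X} (h : PathPartition E (z ::ₘ D)) (hcz : c ≠ z)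
    (hE : (s(c, z) ::ₘ E).Nodup) (hc : ∀ v, s(c, v) ∈ E → v ≠ c ∧ v ∈ z ::ₘ D) :
    PathPartition (s(c, z) ::ₘ E) (c ::ₘ D) := by
  classical
  obtain ⟨P, hP⟩ := h
  have hfin : {v | s(c, v) ∈ E}.Finite := by
    refine (Multiset.finite_toSet (z ::ₘ D)).subset fun v hv => (hc v hv).2
  have hmem : ∀ v, v ∈ hfin.toFinset ↔ s(c, v) ∈ E := by simp
  refine pathPartition_switch_aux c hfin.toFinset z ?_ ?_ hcz.symm hP hE ?_
  · rw [hmem]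
    exact (Multiset.nodup_cons.1 hE).1
  · rw [hmem]
    exact fun h => (hc c h).1 rfl
  · intro u hu
    have huD : u ∈ z ::ₘ D := by
      rw [Finset.mem_insert, hmem] at hu
      rcases hu with rfl | hu
      exacts [Multiset.mem_cons_self _ _, (hc u hu).2]
    have huc : u ≠ c := by
      rw [Finset.mem_insert, hmem] at hu
      rcases hu with rfl | hu
      exacts [hcz.symm, (hc u hu).1]
    obtain ⟨l, hl, hlu⟩ : ∃ l, (l ∈ P ∨ l.reverse ∈ P) ∧ l.head? = some u := by
      rw [← hP.2.2, Multiset.mem_bind] at huD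
      obtain ⟨l, hl, hul⟩ := huD
      rw [List.mem_endpoints_iff] at hul
      rcases hul with h | h
      exacts [⟨l, .inl hl, h⟩, ⟨l.reverse, .inr (by simpa), h⟩]
    refine ⟨l, hl, hlu, ?_⟩
    by_cases hcl : c ∈ l
    · right
      obtain ⟨A, B, rfl⟩ := List.append_of_mem hcl
      rcases List.eq_nil_or_concat A with rfl | ⟨A, a, rfl⟩
      · simp at hlu
        exact absurd hlu.symm huc
      · refine ⟨A, a, B, by simp, ?_⟩
        rw [hmem, ← hP.2.1, Multiset.mem_bind, Sym2.eq_swap]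
        rw [List.concat_eq_append, List.append_assoc, List.singleton_append] at hl
        rcases hl with hl | hl
        · exact ⟨_, hl, List.mk_mem_stepEdges_append _ _ _ _⟩
        · refine ⟨_, hl, ?_⟩
          rw [List.coe_stepEdges_reverse]
          exact List.mk_mem_stepEdges_append _ _ _ _
    · exact .inl hcl

lemma PathPartition.switch_of_fresh {c z : X} (h : PathPartition E (z ::ₘ D)) (hcz : c ≠ z)
    (hE : (s(c, z) ::ₘ E).Nodup) (hc : ∀ e ∈ E, c ∉ e) :
    PathPartition (s(c, z) ::ₘ E) (c ::ₘ D) :=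
  h.switch hcz hE fun v hv => absurd (Sym2.mem_mk_left c v) (hc _ hv)

lemma PathPartition.subdivide {x y r : X} (h : PathPartition (s(x, y) ::ₘ E) D) (hx : r ≠ x)
    (hy : r ≠ y) (hr : ∀ e ∈ E, r ∉ e) : PathPartition (s(x, r) ::ₘ s(r, y) ::ₘ E) D := by
  obtain ⟨P, hP⟩ := h
  obtain ⟨l, hl, hxy⟩ : ∃ l ∈ P, s(x, y) ∈ l.stepEdges := by
    have : s(x, y) ∈ s(x, y) ::ₘ E := by simp
    rw [← hP.2.1, Multiset.mem_bind] at this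
    exact this
  obtain ⟨A, B, hAB⟩ : ∃ A B, l = A ++ x :: y :: B ∨ l.reverse = A ++ x :: y :: B := by
    obtain ⟨A, B, h | h⟩ := List.exists_append_of_mem_stepEdges hxy
    · exact ⟨A, B, .inl h⟩
    · exact ⟨B.reverse, A.reverse, .inr (by simp [h])⟩
  obtain ⟨P, hP, -⟩ := hP.exists_cons (l := A ++ x :: y :: B) (by
    rcases hAB with h | h
    · exact .inl (h ▸ hl)
    · exact .inr (by rw [← h]; simpa))
  rw [isPathSystem_cons] at hP
  obtain ⟨-, hnd, E', D', hP', hE, rfl⟩ := hP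
  have h1 : ((A ++ x :: y :: B).stepEdges : Multiset (Sym2 X))
      = s(x, y) ::ₘ ((A ++ [x]).stepEdges + (y :: B).stepEdges) := by
    rw [List.stepEdges_append_cons, ← Multiset.coe_add, List.stepEdges_cons_cons,
      ← Multiset.cons_coe, Multiset.add_cons]
  have h2 : ((A ++ x :: r :: y :: B).stepEdges : Multiset (Sym2 X))
      = s(x, r) ::ₘ s(r, y) ::ₘ ((A ++ [x]).stepEdges + (y :: B).stepEdges) := by
    rw [List.stepEdges_append_cons, ← Multiset.coe_add, List.stepEdges_cons_cons,
      List.stepEdges_cons_cons, ← Multiset.cons_coe, ← Multiset.cons_coe, Multiset.add_cons,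
      Multiset.add_cons]
  rw [h1, Multiset.cons_add, Multiset.cons_inj_right] at hE
  subst hE
  have hrl : r ∉ A ++ x :: y :: B := by
    intro hrl
    obtain ⟨e, he, hre⟩ := List.exists_mem_stepEdges hrl (by
      intro h
      have := congrArg List.length h
      simp at this
      omega)
    rw [← Multiset.mem_coe, h1, Multiset.mem_cons] at he
    rcases he with rfl | he
    · rw [Sym2.mem_iff] at hre
      exact hre.elim hx hy
    · exact hr e (by rw [Multiset.mem_add]; exact .inl he) hre
  refine ⟨(A ++ x :: r :: y :: B) ::ₘ P, ?_⟩
  rw [isPathSystem_cons]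
  refine ⟨by simp, ?_, E', D', hP', ?_, ?_⟩
  · have : (A ++ x :: r :: y :: B).Perm (r :: (A ++ x :: y :: B)) := by
      have h : A ++ x :: r :: y :: B = (A ++ [x]) ++ r :: y :: B := by simp
      rw [h]
      refine List.perm_middle.trans (by simp)
    exact this.nodup_iff.2 (List.nodup_cons.2 ⟨hrl, hnd⟩)
  · rw [h2]
    simp only [Multiset.cons_add]
  · congr 1
    cases A <;> simp [List.endpoints, List.getLast?_cons, List.getLast?_append]

end PathPartition

section Parity

variable {X : Type*}

open Classical in
/-- The number of elements of `E` incident to `v`. -/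
noncomputable def Multiset.incidence (E : Multiset (Sym2 X)) (v : X) : ℕ :=
  E.countP (fun e => v ∈ e)

namespace Multiset

@[simp] lemma incidence_zero (v : X) : incidence 0 v = 0 := by
  simp [incidence]

lemma incidence_add (E₁ E₂ : Multiset (Sym2 X)) (v : X) :
    (E₁ + E₂).incidence v = E₁.incidence v + E₂.incidence v := by
  simp [incidence]

lemma incidence_cons_of_mem {e : Sym2 X} {v : X} (h : v ∈ e) (E : Multiset (Sym2 X)) :
    (e ::ₘ E).incidence v = E.incidence v + 1 := by
  simp [incidence, h]

lemma incidence_cons_of_notMem {e : Sym2 X} {v : X} (h : v ∉ e) (E : Multiset (Sym2 X)) :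
    (e ::ₘ E).incidence v = E.incidence v := by
  simp [incidence, h]

lemma incidence_eq_zero_iff {E : Multiset (Sym2 X)} {v : X} :
    E.incidence v = 0 ↔ ∀ e ∈ E, v ∉ e := by
  simp [incidence, countP_eq_zero]

lemma incidence_map {Y : Type*} {f : X → Y} (hf : f.Injective) (E : Multiset (Sym2 X)) (v : X) :
    (E.map (Sym2.map f)).incidence (f v) = E.incidence v := by
  rw [incidence, incidence, countP_map, countP_eq_card_filter]
  congr! with e
  rw [Sym2.mem_map]
  exact ⟨fun ⟨a, ha, h⟩ => hf h ▸ ha, fun h => ⟨v, h, rfl⟩⟩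

lemma incidence_edgeFinset [Fintype X] (G : SimpleGraph X) [DecidableRel G.Adj] (v : X) :
    G.edgeFinset.val.incidence v = G.degree v := by
  classical
  rw [← card_incidenceFinset_eq_degree, incidenceFinset_eq_filter, incidence,
    countP_eq_card_filter]
  simp only [Finset.card, Finset.filter_val]

end Multiset

open Classical in
/-- A simple edge multiset can be partitioned into paths with endpoint multiset `D` if the parities
are right and all but at most one of the incident vertices are endpoints. -/
lemma pathPartition_of_even {E : Multiset (Sym2 X)} {D : Multiset X} (z : X) (hE : E.Nodup)
    (hdiag : ∀ e ∈ E, ¬e.IsDiag) (heven : ∀ v, Even (E.incidence v + D.count v))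
    (hz : ∀ v ≠ z, ∀ e ∈ E, v ∈ e → v ∈ D) : PathPartition E D := by
  induction hk : Multiset.card E generalizing E D z with
  | zero =>
    rw [Multiset.card_eq_zero] at hk
    subst hk
    obtain ⟨S, rfl⟩ := Multiset.exists_smul_of_dvd_count D (k := 2) fun v _ => by
      simpa [even_iff_two_dvd] using heven v
    exact pathPartition_zero S
  | succ k ih =>
    obtain ⟨c, l, hcl, hcD, hzl⟩ : ∃ c l, s(c, l) ∈ E ∧ c ∈ D ∧
        (z ∈ D ∨ (∀ e ∈ E, z ∉ e) ∨ z = l) := by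
      by_cases hzD : z ∈ D ∨ ∀ e ∈ E, z ∉ e
      · obtain ⟨e, he⟩ := Multiset.card_pos_iff_exists_mem.1 (by omega : 0 < Multiset.card E)
        induction e with
        | h a b =>
        by_cases ha : a ∈ D
        · exact ⟨a, b, he, ha, by tauto⟩
        · have haz : a = z := by
            by_contra h
            exact ha (hz a h _ he (by simp))
          subst haz
          rcases hzD with h | h
          · exact absurd h ha
          · exact absurd (by simp) (h _ he)
      · push Not at hzD
        obtain ⟨hzD, e, he, hze⟩ := hzD
        obtain ⟨c, rfl⟩ := hze
        refine ⟨c, z, Sym2.eq_swap ▸ he, hz c ?_ _ he (by simp), by simp⟩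
        rintro rfl
        exact hdiag _ he (by simp)
    have hne : c ≠ l := by
      rintro rfl
      exact hdiag _ hcl (by simp)
    obtain ⟨D, rfl⟩ := Multiset.exists_cons_of_mem hcD
    obtain ⟨E, rfl⟩ := Multiset.exists_cons_of_mem hcl
    have hnd := (Multiset.nodup_cons.1 hE).2
    have key : ∀ v ≠ c, ∀ e ∈ E, v ∈ e → v ∈ l ::ₘ D := by
      intro v hv e he hve
      rw [Multiset.mem_cons]
      by_cases hvz : v = z
      · subst hvz
        rcases hzl with h | h | h
        · rw [Multiset.mem_cons] at h; tauto
        · exact absurd hve (h e (by simp [he]))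
        · exact .inl h
      · have := hz v hvz e (by simp [he]) hve
        rw [Multiset.mem_cons] at this
        tauto
    refine (ih c hnd (fun e he => hdiag e (by simp [he])) (fun v => ?_) key
      (by simpa using hk)).switch hne hE fun v hv => ?_
    · have := heven v
      by_cases hvc : v = c
      · subst hvc
        rw [Multiset.incidence_cons_of_mem (by simp), Multiset.count_cons_self] at this
        rw [Multiset.count_cons_of_ne hne]
        grind
      · by_cases hvl : v = l
        · subst hvl
          rw [Multiset.incidence_cons_of_mem (by simp), Multiset.count_cons_of_ne hvc] at this
          rw [Multiset.count_cons_self]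
          grind
        · rw [Multiset.incidence_cons_of_notMem (by simp [hvc, hvl]),
            Multiset.count_cons_of_ne hvc] at this
          rwa [Multiset.count_cons_of_ne hvl]
    · have hvc : v ≠ c := by
        rintro rfl
        exact hdiag s(v, v) (by simp [hv]) (by simp)
      exact ⟨hvc, key v hvc _ hv (by simp)⟩

end Parity

section Map

variable {X Y : Type*}

lemma List.stepEdges_map (f : X → Y) (l : List X) :
    (l.map f).stepEdges = l.stepEdges.map (Sym2.map f) := by
  induction l with
  | nil => rfl
  | cons a l ih => cases l <;> simp_all

lemma List.endpoints_map (f : X → Y) (l : List X) :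
    (l.map f).endpoints = l.endpoints.map f := by
  cases l with
  | nil => rfl
  | cons a l =>
    have h := List.getLast_map (f := f) (l := a :: l) (by simp)
    simp only [List.map_cons] at h
    simp [List.endpoints_cons, h]

lemma PathPartition.map {f : X → Y} (hf : f.Injective) {E : Multiset (Sym2 X)} {D : Multiset X}
    (h : PathPartition E D) : PathPartition (E.map (Sym2.map f)) (D.map f) := by
  obtain ⟨P, hP, rfl, rfl⟩ := h
  refine ⟨P.map (List.map f), fun l hl => ?_, ?_, ?_⟩
  · obtain ⟨k, hk, rfl⟩ := Multiset.mem_map.1 hl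
    exact ⟨by simpa using (hP k hk).1, (hP k hk).2.map hf⟩
  · simp [Multiset.bind_map, Multiset.map_bind, List.stepEdges_map]
  · simp [Multiset.bind_map, Multiset.map_bind, List.endpoints_map]

open Classical in
lemma List.even_incidence_add_count_endpoints {l : List X} (hl : l.Nodup) (v : X) :
    Even ((l.stepEdges : Multiset (Sym2 X)).incidence v + l.endpoints.count v) := by
  induction l with
  | nil => simp [List.endpoints]
  | cons a l ih =>
    cases l with
    | nil =>
      simp only [stepEdges_singleton, Multiset.coe_nil, Multiset.incidence_zero, endpoints_cons,
        getLast_singleton, zero_add, Multiset.count_cons, Multiset.count_singleton]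
      exact ⟨_, rfl⟩
    | cons b l =>
      have ih := ih hl.of_cons
      have hab : a ≠ b := by rintro rfl; simp at hl
      rw [stepEdges_cons_cons, ← Multiset.cons_coe]
      simp only [endpoints_cons, Multiset.count_cons, getLast_cons_cons] at ih ⊢
      by_cases h : v ∈ s(a, b)
      · rw [Multiset.incidence_cons_of_mem h]
        rw [Sym2.mem_iff] at h
        rcases h with rfl | rfl
        · rw [if_neg hab] at ih
          rw [if_pos rfl]
          grind
        · rw [if_pos rfl] at ih
          rw [if_neg hab.symm]
          grind
      · rw [Multiset.incidence_cons_of_notMem h]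
        rw [Sym2.mem_iff, not_or] at h
        rw [if_neg h.2] at ih
        rwa [if_neg h.1]

open Classical in
lemma PathPartition.even_incidence_add_count {E : Multiset (Sym2 X)} {D : Multiset X}
    (h : PathPartition E D) (v : X) : Even (E.incidence v + D.count v) := by
  obtain ⟨P, hP, rfl, rfl⟩ := h
  induction P using Multiset.induction_on with
  | empty => simp
  | cons l P ih =>
    have h1 := List.even_incidence_add_count_endpoints (hP l (by simp)).2 v
    have h2 := ih fun k hk => hP k (by simp [hk])
    rw [Multiset.cons_bind, Multiset.cons_bind, Multiset.incidence_add, Multiset.count_add]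
    grind

lemma Multiset.sum_incidence [Fintype X] {E : Multiset (Sym2 X)} (hE : ∀ e ∈ E, ¬e.IsDiag) :
    ∑ v, E.incidence v = 2 * Multiset.card E := by
  classical
  induction E using Multiset.induction_on with
  | empty => simp
  | cons e E ih =>
    have h : ∀ v, (e ::ₘ E).incidence v = E.incidence v + if v ∈ e then 1 else 0 := by
      intro v
      split_ifs with h
      · exact incidence_cons_of_mem h E
      · exact incidence_cons_of_notMem h E
    simp only [h, Finset.sum_add_distrib]
    rw [ih fun e he => hE e (by simp [he])]
    have h2 : ∑ v, (if v ∈ e then 1 else 0) = 2 := by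
      rw [← Finset.card_filter, ← Sym2.card_toFinset_of_not_isDiag e (hE e (by simp))]
      congr 1
      ext; simp
    rw [h2, card_cons]
    ring

end Map

section Column

variable {W : Type*} (H : SimpleGraph W)

lemma SimpleGraph.exists_parent (q : W) : ∃ par : W → W, ∀ v, v ≠ q → H.Reachable v q →
    H.Adj v (par v) ∧ H.dist (par v) q < H.dist v q := by
  have : ∀ v, ∃ u, v ≠ q → H.Reachable v q → H.Adj v u ∧ H.dist u q < H.dist v q := by
    intro v
    by_cases hv : v ≠ q ∧ H.Reachable v q
    · obtain ⟨p, hp⟩ := hv.2.exists_walk_length_eq_dist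
      cases p with
      | nil => exact absurd rfl hv.1
      | cons h p =>
        refine ⟨_, fun _ _ => ⟨h, ?_⟩⟩
        rw [← hp, Walk.length_cons]
        exact Nat.lt_succ_of_le (dist_le p)
    · exact ⟨v, fun h1 h2 => absurd ⟨h1, h2⟩ hv⟩
  choose par hpar using this
  exact ⟨par, hpar⟩

/-- Deleting suitable parent edges makes all degrees in `R` odd. -/
lemma SimpleGraph.exists_odd_incidence [Fintype W] [DecidableRel H.Adj] (R : Finset W)
    (par : W → W) (rank : W → ℕ)
    (hpar : ∀ v ∈ R, H.Adj v (par v) ∧ rank (par v) < rank v) :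
    ∃ (J : Finset W) (K : Multiset (Sym2 W)), J ⊆ R ∧
      K + J.val.map (fun v => s(v, par v)) = H.edgeFinset.val ∧ ∀ v ∈ R, Odd (K.incidence v) := by
  classical
  induction R using Finset.induction_on_min_value rank with
  | empty => exact ⟨∅, H.edgeFinset.val, by simp, by simp, by simp⟩
  | insert a R ha hmin ih =>
    obtain ⟨J, K, hJ, hK, hodd⟩ := ih fun v hv => hpar v (by simp [hv])
    by_cases h : Odd (K.incidence a)
    · refine ⟨J, K, hJ.trans (by simp), hK, fun v hv => ?_⟩
      rw [Finset.mem_insert] at hv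
      rcases hv with rfl | hv
      exacts [h, hodd v hv]
    · have haJ : a ∉ J := fun h => ha (hJ h)
      obtain ⟨hadj, hlt⟩ := hpar a (by simp)
      have hmem : s(a, par a) ∈ K := by
        have h1 : s(a, par a) ∈ H.edgeFinset.val := by simpa using hadj
        rw [← hK, Multiset.mem_add, Multiset.mem_map] at h1
        refine h1.resolve_right ?_
        rintro ⟨v, hv, hva⟩
        rw [Sym2.eq_iff] at hva
        rcases hva with ⟨rfl, -⟩ | ⟨rfl, -⟩
        · exact haJ hv
        · exact absurd (hmin _ (hJ hv)) (by omega)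
      obtain ⟨K, rfl⟩ := Multiset.exists_cons_of_mem hmem
      refine ⟨insert a J, K, Finset.insert_subset_insert _ hJ, ?_, fun v hv => ?_⟩
      · rw [Finset.insert_val_of_notMem haJ, Multiset.map_cons, Multiset.add_cons, ← hK,
          Multiset.cons_add]
      · rw [Finset.mem_insert] at hv
        rcases hv with rfl | hv
        · rw [Multiset.incidence_cons_of_mem (by simp)] at h
          grind
        · have := hodd v hv
          rwa [Multiset.incidence_cons_of_notMem] at this
          rw [Sym2.mem_iff]
          rintro (rfl | rfl)
          · exact ha hv
          · exact absurd (hmin _ hv) (by omega)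

open Classical in
/-- A connected graph can be decomposed into a part `K` with prescribed path endpoints and a set of
edges joining vertices in `J` to their parents in a rooted tree. -/
lemma SimpleGraph.Connected.exists_pathPartition [Fintype W] [DecidableRel H.Adj]
    (hH : H.Connected) :
    ∃ (ρ : W) (par : W → W) (rank : W → ℕ) (J : Finset W) (K : Multiset (Sym2 W)),
      K + J.val.map (fun v => s(v, par v)) = H.edgeFinset.val ∧
      (∀ v ∈ J, rank (par v) < rank v) ∧
      ((Even (Fintype.card W) ∧ PathPartition K Finset.univ.val) ∨
        (ρ ∉ J ∧ (Odd (H.degree ρ) ∨ ∀ v ∈ J, par v ≠ ρ) ∧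
          PathPartition K (Finset.univ.erase ρ).val)) := by
  have hdiag : ∀ K : Multiset (Sym2 W), K ≤ H.edgeFinset.val →
      K.Nodup ∧ ∀ e ∈ K, ¬e.IsDiag := fun K hK =>
    ⟨Multiset.nodup_of_le hK H.edgeFinset.nodup, fun e he => H.not_isDiag_of_mem_edgeSet
      (mem_edgeFinset.1 (Multiset.mem_of_le hK he))⟩
  have hcard : ∀ K : Multiset (Sym2 W), K ≤ H.edgeFinset.val →
      Even (Finset.univ.filter fun v => Odd (K.incidence v)).card := fun K hK => by
    rw [← Finset.even_sum_iff_even_card_odd, Multiset.sum_incidence (hdiag K hK).2]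
    exact even_two_mul _
  have herase : ∀ (K : Multiset (Sym2 W)) (ρ : W), K ≤ H.edgeFinset.val → Even (K.incidence ρ) →
      (∀ v ≠ ρ, Odd (K.incidence v)) → PathPartition K (Finset.univ.erase ρ).val := by
    intro K ρ hK hρ hodd
    refine pathPartition_of_even ρ (hdiag K hK).1 (hdiag K hK).2 (fun v => ?_)
      fun v hv _ _ _ => by rw [Finset.mem_val]; simp [hv]
    by_cases hv : v = ρ
    · subst hv
      rw [Multiset.count_eq_zero_of_notMem (by rw [Finset.mem_val]; simp)]
      simpa using hρ
    · rw [Multiset.count_eq_one_of_mem (Finset.nodup _) (by rw [Finset.mem_val]; simp [hv])]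
      exact (hodd v hv).add_one
  by_cases hcase : ∃ ρ, Even (Fintype.card W) ∨ Odd (H.degree ρ)
  · obtain ⟨ρ, hρ⟩ := hcase
    obtain ⟨par, hpar⟩ := H.exists_parent ρ
    obtain ⟨J, K, hJ, hK, hodd⟩ := H.exists_odd_incidence (Finset.univ.erase ρ) par
      (fun v => H.dist v ρ) fun v hv => hpar v (by simpa using hv) (hH.preconnected v ρ)
    have hKle : K ≤ H.edgeFinset.val := hK ▸ Multiset.le_add_right _ _
    have hodd' : ∀ v ≠ ρ, Odd (K.incidence v) := fun v hv => hodd v (by simp [hv])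
    refine ⟨ρ, par, fun v => H.dist v ρ, J, K, hK, fun v hv => ?_, ?_⟩
    · exact (hpar v (by simpa using hJ hv) (hH.preconnected v ρ)).2
    by_cases hn : Even (Fintype.card W)
    · refine .inl ⟨hn, ?_⟩
      have hρodd : Odd (K.incidence ρ) := by
        by_contra h
        have h1 : (Finset.univ.filter fun v => Odd (K.incidence v)) = Finset.univ.erase ρ := by
          ext v
          by_cases hv : v = ρ
          · subst hv; simpa using h
          · simpa [hv] using hodd' v hv
        have h2 := hcard K hKle
        rw [h1, Finset.card_erase_of_mem (Finset.mem_univ _), Finset.card_univ] at h2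
        have : 0 < Fintype.card W := Fintype.card_pos_iff.2 ⟨ρ⟩
        grind
      refine pathPartition_of_even ρ (hdiag K hKle).1 (hdiag K hKle).2 (fun v => ?_)
        fun v hv _ _ _ => by simp
      rw [Multiset.count_eq_one_of_mem (Finset.nodup _) (by simp)]
      by_cases hv : v = ρ
      · exact (hv ▸ hρodd).add_one
      · exact (hodd' v hv).add_one
    · refine .inr ⟨fun h => by simpa using hJ h, .inl (hρ.resolve_left hn),
        herase K ρ hKle ?_ hodd'⟩
      by_contra h
      rw [Nat.not_even_iff_odd] at h
      have h1 : (Finset.univ.filter fun v => Odd (K.incidence v)) = Finset.univ := by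
        ext v
        by_cases hv : v = ρ
        · subst hv; simpa using h
        · simpa [hv] using hodd' v hv
      have h2 := hcard K hKle
      rw [h1] at h2
      exact hn h2
  · push Not at hcase
    obtain ⟨ρ, q, H', hH', hreach, hq⟩ : ∃ (ρ q : W) (H' : SimpleGraph W),
        (∀ v w, H'.Adj v w → H.Adj v w ∧ w ≠ ρ) ∧ (∀ v ≠ ρ, H'.Reachable v q) ∧
          (q ≠ ρ ∨ ∀ v, v = ρ) := by
      rcases subsingleton_or_nontrivial W with hW | hW
      · obtain ⟨ρ⟩ := hH.nonempty
        exact ⟨ρ, ρ, ⊥, by simp, fun v hv => absurd (Subsingleton.elim v ρ) hv,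
          .inr fun v => Subsingleton.elim v ρ⟩
      · obtain ⟨ρ, hρ⟩ := hH.exists_connected_induce_compl_singleton_of_finite_nontrivial
        obtain ⟨q, hq⟩ := exists_ne ρ
        refine ⟨ρ, q, (H.induce {ρ}ᶜ).spanningCoe, ?_, fun v hv => ?_, .inl hq⟩
        · intro v w hvw
          simp at hvw
          tauto
        · exact (hρ.preconnected ⟨v, hv⟩ ⟨q, hq⟩).map
            (SimpleGraph.Embedding.spanningCoe (H.induce {ρ}ᶜ)).toHom
    obtain ⟨par, hpar⟩ := H'.exists_parent q
    have hpar' : ∀ v ∈ (Finset.univ.erase ρ).erase q,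
        H'.Adj v (par v) ∧ H'.dist (par v) q < H'.dist v q := by
      intro v hv
      simp only [Finset.mem_erase, Finset.mem_univ, and_true] at hv
      exact hpar v hv.1 (hreach v hv.2)
    obtain ⟨J, K, hJ, hK, hodd⟩ := H.exists_odd_incidence ((Finset.univ.erase ρ).erase q) par
      (fun v => H'.dist v q) fun v hv => ⟨(hH' _ _ (hpar' v hv).1).1, (hpar' v hv).2⟩
    have hKle : K ≤ H.edgeFinset.val := hK ▸ Multiset.le_add_right _ _
    have hparρ : ∀ v ∈ J, par v ≠ ρ := fun v hv => (hH' _ _ (hpar' v (hJ hv)).1).2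
    have hρJ : ρ ∉ J := fun h => by simpa using hJ h
    have hρK : Even (K.incidence ρ) := by
      have h1 := congrArg (fun E => E.incidence ρ) hK
      simp only [Multiset.incidence_add, Multiset.incidence_edgeFinset] at h1
      have h2 : (J.val.map fun v => s(v, par v)).incidence ρ = 0 := by
        rw [Multiset.incidence_eq_zero_iff]
        intro e he
        obtain ⟨v, hv, rfl⟩ := Multiset.mem_map.1 he
        rw [Sym2.mem_iff, not_or]
        exact ⟨fun h => hρJ (h ▸ hv), fun h => hparρ v hv h.symm⟩
      rw [h2, add_zero] at h1
      rw [h1]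
      exact Nat.not_odd_iff_even.1 (hcase ρ).2
    refine ⟨ρ, par, fun v => H'.dist v q, J, K, hK, fun v hv => (hpar' v (hJ hv)).2,
      .inr ⟨hρJ, .inr hparρ, herase K ρ hKle hρK fun v hv => ?_⟩⟩
    by_cases hvq : v = q
    · subst hvq
      by_contra h
      have h1 : (Finset.univ.filter fun v => Odd (K.incidence v))
          = (Finset.univ.erase ρ).erase v := by
        ext w
        by_cases hw : w ∈ (Finset.univ.erase ρ).erase v
        · simpa [hw] using hodd w hw
        · rw [iff_false_right hw]
          simp only [Finset.mem_erase, Finset.mem_univ, and_true, not_and_or, not_not] at hw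
          rcases hw with rfl | rfl
          · simpa using h
          · simpa using hρK
      have h2 := hcard K hKle
      rw [h1, Finset.card_erase_of_mem (by simp [hv]),
        Finset.card_erase_of_mem (Finset.mem_univ _), Finset.card_univ] at h2
      have h3 := (hcase ρ).1
      have : 1 < Fintype.card W := Fintype.one_lt_card_iff.2 ⟨_, _, hv⟩
      grind
    · exact hodd v (by simp [hv, hvq])

end Column

section Sweep

variable {V W : Type*}

lemma PathPartition.exists_sweep [DecidableEq W] {c z : V} (hcz : c ≠ z)
    {E₀ : Multiset (Sym2 (V × W))} {D₀ : Multiset (V × W)} (h₀ : PathPartition E₀ D₀)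
    (R B : Finset W) (p : W → Prop) [DecidablePred p]
    (par : W → W) (rank : W → ℕ) (hrank : ∀ v, p v → rank (par v) < rank v)
    (hB : ∀ v, p v → par v ∉ B) (hRB : ∀ v ∈ R, v ∉ B)
    (hnbr : ∀ h x, s((c, h), x) ∈ E₀ → x ≠ (c, h) ∧ ((∃ h', x = (c, h')) ∨ x = (z, h)))
    (hc : ∀ h, (c, h) ∈ D₀) (hz : ∀ h ∉ B, (z, h) ∈ D₀)
    (hnd : (E₀ + ((R.filter p).val.map fun v => s((c, v), (c, par v)))
      + (R.val.map fun v => s((c, v), (z, v)))).Nodup) :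
    ∃ D, PathPartition (E₀ + ((R.filter p).val.map fun v => s((c, v), (c, par v)))
      + (R.val.map fun v => s((c, v), (z, v)))) D ∧ (∀ h, (c, h) ∈ D) ∧
      (∀ h ∉ B, h ∉ R → (z, h) ∈ D) ∧ Multiset.card D = Multiset.card D₀ := by
  induction R using Finset.induction_on_min_value rank with
  | empty => exact ⟨D₀, by simpa using h₀, hc, fun h hh _ => hz h hh, rfl⟩
  | insert a R ha hmin ih =>
    have key : ∀ h x, s((c, h), x) ∈ E₀ + ((R.filter p).val.map fun v => s((c, v), (c, par v)))
        + (R.val.map fun v => s((c, v), (z, v))) →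
        x ≠ (c, h) ∧ ((∃ h', x = (c, h')) ∨ x = (z, h)) := by
      intro h x hx
      rw [Multiset.mem_add, Multiset.mem_add, Multiset.mem_map, Multiset.mem_map] at hx
      rcases hx with (hx | ⟨v, hv, hx⟩) | ⟨v, -, hx⟩
      · exact hnbr h x hx
      · have hne : par v ≠ v := fun h => by
          have := hrank v (Finset.mem_filter.1 hv).2
          rw [h] at this
          exact lt_irrefl _ this
        rw [Sym2.eq_iff] at hx
        rcases hx with ⟨h1, rfl⟩ | ⟨rfl, h1⟩ <;> simp_all [Prod.ext_iff]
        exact fun h => hne h.symm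
      · rw [Sym2.eq_iff] at hx
        rcases hx with ⟨h1, rfl⟩ | ⟨rfl, h1⟩ <;> simp_all [Prod.ext_iff]
        exact fun h => hcz h.symm
    have hJ : (insert a R).filter p = if p a then insert a (R.filter p) else R.filter p :=
      Finset.filter_insert ..
    have haJ : a ∉ R.filter p := fun h => ha (Finset.mem_filter.1 h).1
    rw [Finset.insert_val_of_notMem ha, Multiset.map_cons, Multiset.add_cons] at hnd ⊢
    set E₁ := E₀ + ((R.filter p).val.map fun v => s((c, v), (c, par v)))
        + (R.val.map fun v => s((c, v), (z, v))) with hE₁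
    obtain ⟨E₂, hE₂, D, hD, hcD, hzD, hcard⟩ : ∃ E₂, E₀ + (((insert a R).filter p).val.map
        fun v => s((c, v), (c, par v))) + (R.val.map fun v => s((c, v), (z, v))) = E₂ ∧
        ∃ D, PathPartition E₂ D ∧ (∀ h ≠ a, (c, h) ∈ D) ∧ (∀ h ∉ B, h ∉ R → (z, h) ∈ D) ∧
          Multiset.card D = Multiset.card D₀ := by
      have hnd := (Multiset.nodup_cons.1 hnd).2
      refine ⟨_, rfl, ?_⟩
      rw [hJ] at hnd ⊢
      split_ifs at hnd ⊢ with hpa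
      · rw [Finset.insert_val_of_notMem haJ, Multiset.map_cons, Multiset.add_cons,
          Multiset.cons_add, ← hE₁] at hnd ⊢
        obtain ⟨D, hD, hcD, hzD, hcard⟩ := ih (fun v hv => hRB v (by simp [hv]))
          (Multiset.nodup_cons.1 hnd).2
        obtain ⟨D, rfl⟩ := Multiset.exists_cons_of_mem (hcD a)
        have hlt := hrank a hpa
        have hpaR : par a ∉ R := fun h => absurd (hmin _ h) (by omega)
        have hne : par a ≠ a := fun h => by rw [h] at hlt; omega
        rw [Sym2.eq_swap] at hnd ⊢
        refine ⟨(c, par a) ::ₘ D, hD.switch (by simpa) hnd fun x hx => ?_, fun h hh => ?_,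
          fun h h1 h2 => ?_, by simpa using hcard⟩
        · obtain ⟨h1, ⟨h', rfl⟩ | rfl⟩ := key _ _ hx
          · exact ⟨h1, hcD h'⟩
          · exact ⟨h1, hzD _ (hB a hpa) hpaR⟩
        · have := hcD h
          simp only [Multiset.mem_cons, Prod.mk.injEq, true_and] at this ⊢
          tauto
        · have := hzD h h1 h2
          simp only [Multiset.mem_cons, Prod.mk.injEq, hcz.symm, false_and, false_or] at this ⊢
          exact this
      · obtain ⟨D, hD, hcD, hzD, hcard⟩ := ih (fun v hv => hRB v (by simp [hv])) hnd
        exact ⟨D, hD, fun h _ => hcD h, hzD, hcard⟩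
    have key₂ : ∀ x, s((c, a), x) ∈ E₂ → x ≠ (c, a) ∧ ((∃ h', x = (c, h')) ∨ x = (z, a)) := by
      intro x hx
      rw [← hE₂, hJ] at hx
      split_ifs at hx with hpa
      · rw [Finset.insert_val_of_notMem haJ, Multiset.map_cons, Multiset.add_cons,
          Multiset.cons_add, ← hE₁, Multiset.mem_cons] at hx
        rcases hx with hx | hx
        · have hne : par a ≠ a := fun h => by
            have := hrank a hpa
            rw [h] at this
            exact lt_irrefl _ this
          rw [Sym2.eq_iff] at hx
          rcases hx with ⟨-, rfl⟩ | ⟨h1, -⟩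
          · exact ⟨by simpa using hne, .inl ⟨_, rfl⟩⟩
          · simp only [Prod.mk.injEq, true_and] at h1
            exact absurd h1.symm hne
        · exact key a x hx
      · exact key a x hx
    rw [hE₂] at hnd ⊢
    obtain ⟨D, rfl⟩ := Multiset.exists_cons_of_mem (hzD a (hRB a (by simp)) ha)
    refine ⟨(c, a) ::ₘ D, hD.switch (by simp [hcz]) hnd fun x hx => ?_, fun h => ?_,
      fun h h1 h2 => ?_, by simpa using hcard⟩
    · obtain ⟨h1, ⟨h', rfl⟩ | rfl⟩ := key₂ x hx
      · exact ⟨h1, hcD h' (by simpa using h1)⟩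
      · exact ⟨h1, by simp⟩
    · by_cases hh : h = a
      · simp [hh]
      · have := hcD h hh
        simp only [Multiset.mem_cons, Prod.mk.injEq, hcz, false_and, false_or] at this
        simp [this]
    · have := hzD h h1 fun hR => h2 (by simp [hR])
      rw [Finset.mem_insert, not_or] at h2
      simp only [Multiset.mem_cons, Prod.mk.injEq, true_and, h2.1, false_or] at this
      simp [this]

end Sweep

section Attach

variable {V W : Type*} [Fintype W]

/-- The copies of the edge `e` in all layers `V × {h}`. -/
def layerCopies (W : Type*) [Fintype W] (e : Sym2 V) : Multiset (Sym2 (V × W)) :=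
  Finset.univ.val.map fun h : W => e.map fun v => (v, h)

/-- The copy of the edges of `H` in the column `{v} × W`. -/
def columnEdges (H : SimpleGraph W) [DecidableRel H.Adj] (v : V) : Multiset (Sym2 (V × W)) :=
  H.edgeFinset.val.map (Sym2.map (Prod.mk v))

lemma layerCopies_mk (x y : V) : layerCopies W s(x, y)
    = Finset.univ.val.map fun h : W => s((x, h), (y, h)) := rfl

lemma mem_layerCopies {e : Sym2 V} {f : Sym2 (V × W)} :
    f ∈ layerCopies W e ↔ ∃ h, e.map (fun v => (v, h)) = f := by
  simp [layerCopies]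

lemma fst_of_mem_columnEdges {H : SimpleGraph W} [DecidableRel H.Adj] {v : V}
    {f : Sym2 (V × W)} (hf : f ∈ columnEdges H v) {x : V × W} (hx : x ∈ f) : x.1 = v := by
  obtain ⟨e, -, rfl⟩ := Multiset.mem_map.1 hf
  obtain ⟨y, -, rfl⟩ := Sym2.mem_map.1 hx
  rfl

lemma fst_of_mem_layerCopies {e : Sym2 V} {f : Sym2 (V × W)} (hf : f ∈ layerCopies W e)
    {x : V × W} (hx : x ∈ f) : x.1 ∈ e := by
  obtain ⟨h, rfl⟩ := mem_layerCopies.1 hf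
  obtain ⟨y, hy, rfl⟩ := Sym2.mem_map.1 hx
  exact hy

variable (H : SimpleGraph W) [DecidableRel H.Adj]

open Classical in
lemma PathPartition.exists_attach_column (hH : H.Connected) {c z : V} (hcz : c ≠ z)
    {E : Multiset (Sym2 (V × W))} {D : Multiset (V × W)} (hD : PathPartition E D)
    (hfresh : ∀ e ∈ E, ∀ h, (c, h) ∉ e) (hz : ∀ h, (z, h) ∈ D)
    (hodd : ∀ h, Odd (H.degree h) → 2 ≤ D.count (z, h))
    (hnd : (E + columnEdges H c + layerCopies W s(c, z)).Nodup) :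
    ∃ D', PathPartition (E + columnEdges H c + layerCopies W s(c, z)) D' ∧
      (∀ h, (c, h) ∈ D') ∧ Multiset.card D' ≤ Multiset.card D + Fintype.card W := by
  obtain ⟨ρ, par, rank, J, K, hK, hrank, hcase⟩ := hH.exists_pathPartition
  have hcinj : Function.Injective (Prod.mk c : W → V × W) := fun a b h => by simpa using h
  have hcol : columnEdges H c = K.map (Sym2.map (Prod.mk c))
      + J.val.map fun v => s((c, v), (c, par v)) := by
    rw [columnEdges, ← hK, Multiset.map_add, Multiset.map_map]
    rfl
  have hKnbr : ∀ h x, s((c, h), x) ∈ E + K.map (Sym2.map (Prod.mk c)) →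
      x ≠ (c, h) ∧ ∃ h', x = (c, h') := by
    intro h x hx
    rw [Multiset.mem_add] at hx
    rcases hx with hx | hx
    · exact absurd (Sym2.mem_mk_left _ _) (hfresh _ hx h)
    · obtain ⟨e, he, hex⟩ := Multiset.mem_map.1 hx
      have hxe : x ∈ Sym2.map (Prod.mk c) e := hex ▸ Sym2.mem_mk_right _ _
      obtain ⟨y, -, rfl⟩ := Sym2.mem_map.1 hxe
      refine ⟨?_, y, rfl⟩
      intro hyh
      rw [← hyh] at hex
      have heH : e ∈ H.edgeFinset.val := hK ▸ Multiset.mem_add.2 (.inl he)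
      refine H.not_isDiag_of_mem_edgeSet (mem_edgeFinset.1 heH) ?_
      rw [← Sym2.isDiag_map hcinj, hex]
      rfl
  have hJ : Finset.univ.filter (· ∈ J) = J := by ext; simp
  rcases hcase with ⟨-, hKD⟩ | ⟨hρJ, hρ, hKD⟩
  · have hsum : E + columnEdges H c + layerCopies W s(c, z) = E + K.map (Sym2.map (Prod.mk c))
        + ((Finset.univ.filter (· ∈ J)).val.map fun v => s((c, v), (c, par v)))
        + (Finset.univ.val.map fun v => s((c, v), (z, v))) := by
      rw [hJ, hcol, layerCopies_mk]
      simp only [add_assoc]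
    rw [hsum] at hnd ⊢
    obtain ⟨D', hD', hcD, -, hcard⟩ := (hD.add (hKD.map hcinj)).exists_sweep hcz Finset.univ ∅
      (· ∈ J) par rank hrank (by simp) (by simp)
      (fun h x hx => ⟨(hKnbr h x hx).1, .inl (hKnbr h x hx).2⟩) (fun h => by simp)
      (fun h _ => by simp [hz]) hnd
    exact ⟨D', hD', hcD, by simp [hcard]⟩
  · have hρR : ρ ∉ (Finset.univ : Finset W).erase ρ := by simp
    have huniv : (Finset.univ : Finset W).val = ρ ::ₘ (Finset.univ.erase ρ).val := by
      rw [← Finset.insert_val_of_notMem hρR, Finset.insert_erase (Finset.mem_univ _)]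
    have hJ' : (Finset.univ.erase ρ).filter (· ∈ J) = J := by
      ext v
      simp only [Finset.mem_filter, Finset.mem_erase, Finset.mem_univ, and_true]
      exact ⟨fun h => h.2, fun h => ⟨fun h' => hρJ (h' ▸ h), h⟩⟩
    have hsum : E + columnEdges H c + layerCopies W s(c, z) =
        (s((c, ρ), (z, ρ)) ::ₘ (E + K.map (Sym2.map (Prod.mk c))))
        + (((Finset.univ.erase ρ).filter (· ∈ J)).val.map fun v => s((c, v), (c, par v)))
        + ((Finset.univ.erase ρ).val.map fun v => s((c, v), (z, v))) := by
      rw [hJ', hcol, layerCopies_mk, huniv, Multiset.map_cons, Multiset.add_cons,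
        Multiset.cons_add, Multiset.cons_add]
      simp only [add_assoc]
    rw [hsum] at hnd ⊢
    obtain ⟨D, rfl⟩ := Multiset.exists_cons_of_mem (hz ρ)
    have h₁ := (hD.add (hKD.map hcinj))
    rw [Multiset.cons_add] at h₁
    have hmemc : ∀ h ≠ ρ, (c, h) ∈ ((Finset.univ : Finset W).erase ρ).val.map (Prod.mk c) := by
      intro h hh
      refine Multiset.mem_map_of_mem _ ?_
      rw [Finset.mem_val]
      simp [hh]
    have h₂ := h₁.switch (c := (c, ρ)) (by simp [hcz])
      (Multiset.nodup_of_le (by rw [add_assoc]; exact Multiset.le_add_right _ _) hnd)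
      fun x hx => by
        obtain ⟨hx1, h', rfl⟩ := hKnbr ρ x hx
        exact ⟨hx1, Multiset.mem_cons_of_mem (Multiset.mem_add.2
          (.inr (hmemc h' (by simpa using hx1))))⟩
    obtain ⟨D', hD', hcD, -, hcard⟩ := h₂.exists_sweep hcz (Finset.univ.erase ρ)
      (if Odd (H.degree ρ) then ∅ else {ρ}) (· ∈ J) par rank hrank
      (fun v hv => by split_ifs with h <;> simp; exact hρ.resolve_left h v hv)
      (fun v hv => by
        split_ifs with h
        · simp
        · simpa using (Finset.mem_erase.1 hv).1)
      (fun h x hx => by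
        rw [Multiset.mem_cons] at hx
        rcases hx with hx | hx
        · rw [Sym2.eq_iff] at hx
          rcases hx with ⟨h1, rfl⟩ | ⟨h1, -⟩
          · simp only [Prod.mk.injEq, true_and] at h1
            subst h1
            exact ⟨by simp [hcz.symm], .inr rfl⟩
          · simp [hcz] at h1
        · exact ⟨(hKnbr h x hx).1, .inl (hKnbr h x hx).2⟩)
      (fun h => by
        by_cases hh : h = ρ
        · simp [hh]
        · exact Multiset.mem_cons_of_mem (Multiset.mem_add.2 (.inr (hmemc h hh))))
      (fun h hh => by
        refine Multiset.mem_cons_of_mem (Multiset.mem_add.2 (.inl ?_))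
        by_cases hhρ : h = ρ
        · subst hhρ
          split_ifs at hh with hho
          · have := hodd h hho
            rw [Multiset.count_cons_self] at this
            exact Multiset.count_pos.1 (by omega)
          · simp at hh
        · have := hz h
          simpa [hhρ] using this) hnd
    refine ⟨D', hD', hcD, ?_⟩
    have h4 : Multiset.card ((Finset.univ : Finset W).erase ρ).val + 1 = Fintype.card W := by
      rw [← Finset.card_univ, Finset.card_def, huniv, Multiset.card_cons]
    simp only [hcard, Multiset.card_cons, Multiset.card_add, Multiset.card_map, ← h4]
    omega

end Attach

section Tile

variable {V W : Type*}

lemma incidence_map_layer [DecidableEq W] {c z : V} (hcz : c ≠ z) (T : Finset W) (h : W) :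
    (T.val.map fun h => s((c, h), (z, h))).incidence (c, h) = if h ∈ T then 1 else 0 := by
  induction T using Finset.induction_on with
  | empty => simp
  | insert a T ha ih =>
    rw [Finset.insert_val_of_notMem ha, Multiset.map_cons]
    by_cases hh : h = a
    · subst hh
      rw [Multiset.incidence_cons_of_mem (by simp), ih]
      simp [ha]
    · rw [Multiset.incidence_cons_of_notMem (by simp [hh, hcz]), ih]
      simp [hh]

variable [Fintype W] (H : SimpleGraph W) [DecidableRel H.Adj]

lemma incidence_columnEdges (v : V) (h : W) :
    (columnEdges H v).incidence (v, h) = H.degree h := by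
  rw [columnEdges, Multiset.incidence_map (fun a b h => by simpa using h),
    Multiset.incidence_edgeFinset]

lemma incidence_columnEdges_of_ne {v c : V} (hvc : v ≠ c) (h : W) :
    (columnEdges H c).incidence (v, h) = 0 := by
  rw [Multiset.incidence_eq_zero_iff]
  exact fun e he hv => hvc (fst_of_mem_columnEdges he hv)

/-- The edges of layer copies of `E` together with the columns over `S`. -/
def prodEdges (E : Multiset (Sym2 V)) (S : Multiset V) : Multiset (Sym2 (V × W)) :=
  E.bind (layerCopies W) + S.bind (columnEdges H)

lemma prodEdges_add (E₁ E₂ : Multiset (Sym2 V)) (S₁ S₂ : Multiset V) :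
    prodEdges H (E₁ + E₂) (S₁ + S₂) = prodEdges H E₁ S₁ + prodEdges H E₂ S₂ := by
  simp only [prodEdges, Multiset.add_bind]
  abel

lemma prodEdges_cons_left (e : Sym2 V) (E : Multiset (Sym2 V)) (S : Multiset V) :
    prodEdges H (e ::ₘ E) S = layerCopies W e + prodEdges H E S := by
  simp [prodEdges, add_assoc]

lemma prodEdges_cons_right (E : Multiset (Sym2 V)) (v : V) (S : Multiset V) :
    prodEdges H E (v ::ₘ S) = columnEdges H v + prodEdges H E S := by
  simp only [prodEdges, Multiset.cons_bind]
  abel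

lemma fst_of_mem_prodEdges {E : Multiset (Sym2 V)} {S : Multiset V} {f : Sym2 (V × W)}
    (hf : f ∈ prodEdges H E S) {x : V × W} (hx : x ∈ f) : x.1 ∈ S ∨ ∃ e ∈ E, x.1 ∈ e := by
  rw [prodEdges, Multiset.mem_add, Multiset.mem_bind, Multiset.mem_bind] at hf
  rcases hf with ⟨e, he, hf⟩ | ⟨v, hv, hf⟩
  · exact .inr ⟨e, he, fst_of_mem_layerCopies hf hx⟩
  · exact .inl (fst_of_mem_columnEdges hf hx ▸ hv)

lemma nodup_prodEdges {E : Multiset (Sym2 V)} {S : Multiset V} (hE : E.Nodup)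
    (hdiag : ∀ e ∈ E, ¬e.IsDiag) (hS : S.Nodup) : (prodEdges H E S).Nodup := by
  have hfstE : ∀ e : Sym2 V, ∀ f ∈ layerCopies W e, f.map Prod.fst = e := by
    intro e f hf
    obtain ⟨h, rfl⟩ := mem_layerCopies.1 hf
    rw [Sym2.map_map]
    exact (congrFun Sym2.map_id' e : e.map (fun v => v) = e)
  have hfstS : ∀ v : V, ∀ f ∈ columnEdges H v, f.map Prod.fst = s(v, v) := by
    intro v f hf
    obtain ⟨e, -, rfl⟩ := Multiset.mem_map.1 hf
    induction e with | h a b => rfl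
  rw [prodEdges, Multiset.nodup_add]
  refine ⟨?_, ?_, ?_⟩
  · rw [Multiset.nodup_bind]
    refine ⟨fun e _ => Finset.univ.nodup.map fun h h' hh => ?_, ?_⟩
    · induction e with
      | h a b =>
        have : (a, h) ∈ s((a, h'), (b, h')) := by
          have hh : s((a, h), (b, h)) = s((a, h'), (b, h')) := hh
          rw [← hh]
          exact Sym2.mem_mk_left _ _
        simp only [Sym2.mem_iff, Prod.mk.injEq] at this
        exact this.elim And.right And.right
    · refine hE.pairwise fun a _ b _ hab => ?_
      rw [Function.onFun, Multiset.disjoint_left]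
      exact fun {f} h1 h2 => hab ((hfstE a f h1).symm.trans (hfstE b f h2))
  · rw [Multiset.nodup_bind]
    refine ⟨fun v _ => H.edgeFinset.nodup.map (Sym2.map.injective fun a b h => by simpa using h),
      ?_⟩
    refine hS.pairwise fun a _ b _ hab => ?_
    rw [Function.onFun, Multiset.disjoint_left]
    intro f h1 h2
    have := (hfstS a f h1).symm.trans (hfstS b f h2)
    simp at this
    exact hab this
  · rw [Multiset.disjoint_left]
    intro f h1 h2
    obtain ⟨e, he, h1⟩ := Multiset.mem_bind.1 h1
    obtain ⟨v, -, h2⟩ := Multiset.mem_bind.1 h2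
    have := (hfstE e f h1).symm.trans (hfstS v f h2)
    exact hdiag e he (this ▸ rfl)

lemma count_map_mk_add_map_mk [DecidableEq (V × W)] {v w : V} (hvw : v ≠ w) (h : W) :
    Multiset.count (v, h)
      ((Finset.univ : Finset W).val.map (Prod.mk v) + Finset.univ.val.map (Prod.mk w)) = 1 := by
  classical
  rw [Multiset.count_add, Multiset.count_eq_zero_of_notMem (a := (v, h))
    (s := Finset.univ.val.map (Prod.mk w)) (by simp [hvw.symm]), add_zero]
  exact Multiset.count_eq_one_of_mem
    (Finset.univ.nodup.map fun a b h => by simpa using h)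
    (Multiset.mem_map_of_mem _ (Finset.mem_univ h))

open Classical in
lemma exists_pathPartition_two_columns {c z : V} (hcz : c ≠ z)
    (hnd : (layerCopies W s(c, z) + (columnEdges H c + columnEdges H z)).Nodup) :
    ∃ D, PathPartition (layerCopies W s(c, z) + (columnEdges H c + columnEdges H z)) D ∧
      (∀ h, (c, h) ∈ D) ∧ Multiset.card D = 2 * Fintype.card W := by
  set T : Finset W := Finset.univ.filter fun h => Even (H.degree h) with hT
  set E₀ := (T.val.map fun h => s((c, h), (z, h))) + (columnEdges H c + columnEdges H z) with hE₀
  set D₀ : Multiset (V × W) := Finset.univ.val.map (Prod.mk c) + Finset.univ.val.map (Prod.mk z)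
    with hD₀
  have hinj : ∀ v : V, Function.Injective (Prod.mk v : W → V × W) := fun v a b h => by
    simpa using h
  have hsum : layerCopies W s(c, z) + (columnEdges H c + columnEdges H z)
      = E₀ + (((Finset.univ.filter fun h => ¬Even (H.degree h)).filter fun _ => False).val.map
        fun v => s((c, v), (c, id v)))
        + ((Finset.univ.filter fun h => ¬Even (H.degree h)).val.map
          fun h => s((c, h), (z, h))) := by
    have h1 : (Finset.univ : Finset W).val = T.val
        + (Finset.univ.filter fun h => ¬Even (H.degree h)).val := by
      rw [hT, Finset.filter_val, Finset.filter_val, Multiset.filter_add_not]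
    rw [layerCopies_mk, h1, Multiset.map_add, hE₀]
    simp only [Finset.filter_false, Finset.empty_val, Multiset.map_zero, add_zero]
    abel
  rw [hsum] at hnd ⊢
  have hE₀nd : E₀.Nodup := Multiset.nodup_of_le
    (by rw [add_assoc]; exact Multiset.le_add_right _ _) hnd
  have hdeg : ∀ h, Even ((if h ∈ T then 1 else 0) + H.degree h + 1) := by
    intro h
    by_cases hh : Even (H.degree h)
    · rw [if_pos (by simp [hT, hh])]; grind
    · rw [if_neg (by simp [hT, hh])]; grind
  have hmem : ∀ e ∈ E₀, ∀ x ∈ e, x.1 = c ∨ x.1 = z := by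
    intro e he x hx
    simp only [hE₀, Multiset.mem_add, Multiset.mem_map] at he
    rcases he with ⟨h, -, rfl⟩ | he | he
    · rw [Sym2.mem_iff] at hx
      rcases hx with rfl | rfl <;> simp
    · exact .inl (fst_of_mem_columnEdges he hx)
    · exact .inr (fst_of_mem_columnEdges he hx)
  have hcoldiag : ∀ v : V, ∀ e ∈ columnEdges H v, ¬e.IsDiag := by
    intro v e he
    obtain ⟨f, hf, rfl⟩ := Multiset.mem_map.1 he
    rw [Sym2.isDiag_map (hinj v)]
    exact H.not_isDiag_of_mem_edgeSet (mem_edgeFinset.1 hf)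
  have hdiag : ∀ e ∈ E₀, ¬e.IsDiag := by
    intro e he
    simp only [hE₀, Multiset.mem_add, Multiset.mem_map] at he
    rcases he with ⟨h, -, rfl⟩ | he | he
    · simp [hcz]
    · exact hcoldiag _ e he
    · exact hcoldiag _ e he
  have hmemD : ∀ v, v = c ∨ v = z → ∀ h, (v, h) ∈ D₀ := by
    rintro v (rfl | rfl) h <;> simp [hD₀]
  obtain ⟨w⟩ | hW := isEmpty_or_nonempty W
  · refine ⟨0, ?_, fun h => isEmptyElim h, by simp⟩
    have : ∀ M : Multiset (Sym2 (V × W)), M = 0 := fun M =>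
      Multiset.eq_zero_of_forall_notMem fun e => by
        induction e with | h a b => exact isEmptyElim a.2
    rw [this (_ + _)]
    exact pathPartition_zero 0
  obtain ⟨w⟩ := hW
  have h₀ : PathPartition E₀ D₀ := by
    refine pathPartition_of_even (c, w) hE₀nd hdiag (fun x => ?_)
      fun x _ e he hx => hmemD x.1 (hmem e he x hx) x.2
    obtain ⟨v, h⟩ := x
    by_cases hvc : v = c
    · subst hvc
      rw [hD₀, @count_map_mk_add_map_mk _ _ _ (fun x y => propDecidable (x = y)) _ _ hcz,
        hE₀, Multiset.incidence_add, Multiset.incidence_add,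
        incidence_map_layer hcz, incidence_columnEdges, incidence_columnEdges_of_ne H hcz, add_zero]
      exact hdeg h
    by_cases hvz : v = z
    · subst hvz
      have hswap : ∀ h : W, s((c, h), (v, h)) = s((v, h), (c, h)) := fun h => Sym2.eq_swap
      rw [hD₀, add_comm (Multiset.map _ _),
        @count_map_mk_add_map_mk _ _ _ (fun x y => propDecidable (x = y)) _ _ hvc, hE₀,
        Multiset.incidence_add,
        Multiset.incidence_add]
      simp only [hswap]
      rw [incidence_map_layer hvc, incidence_columnEdges, incidence_columnEdges_of_ne H hvc,
        zero_add]
      exact hdeg h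
    · rw [Multiset.incidence_eq_zero_iff.2 fun e he hx => (hmem e he _ hx).elim hvc hvz,
        @Multiset.count_eq_zero_of_notMem _ (fun x y => propDecidable (x = y))]
      · simp
      · simp [hD₀, Ne.symm hvc, Ne.symm hvz]
  obtain ⟨D, hD, hcD, -, hcard⟩ := h₀.exists_sweep hcz
    (Finset.univ.filter fun h => ¬Even (H.degree h)) ∅ (fun _ => False) id (fun _ => 0)
    (by simp) (by simp) (by simp)
    (fun h x hx => by
      refine ⟨fun hxh => hdiag _ hx (by rw [hxh]; rfl), ?_⟩
      simp only [hE₀, Multiset.mem_add, Multiset.mem_map] at hx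
      rcases hx with ⟨h', -, hx⟩ | hx | hx
      · rw [Sym2.eq_iff] at hx
        rcases hx with ⟨h1, rfl⟩ | ⟨-, h1⟩
        · simp only [Prod.mk.injEq, true_and] at h1
          exact .inr (by rw [h1])
        · simp [hcz.symm] at h1
      · exact .inl ⟨x.2, Prod.ext (fst_of_mem_columnEdges hx (Sym2.mem_mk_right _ _)) rfl⟩
      · exact absurd (fst_of_mem_columnEdges hx (Sym2.mem_mk_left _ _)) hcz)
    (hmemD c (.inl rfl)) (fun h _ => hmemD z (.inr rfl) h) hnd
  refine ⟨D, hD, hcD, ?_⟩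
  rw [hcard, hD₀]
  simp [two_mul]

end Tile

section PathTile

variable {V W : Type*}

lemma PathPartition.subdivide_layers {x y r : V} {E : Multiset (Sym2 (V × W))}
    {D : Multiset (V × W)} (T : Finset W)
    (h : PathPartition ((T.val.map fun h => s((x, h), (y, h))) + E) D) (hx : r ≠ x) (hy : r ≠ y)
    (hr : ∀ e ∈ E, ∀ h, (r, h) ∉ e) :
    PathPartition ((T.val.map fun h => s((x, h), (r, h)))
      + (T.val.map fun h => s((r, h), (y, h))) + E) D := by
  classical
  induction T using Finset.induction_on generalizing E with
  | empty => simpa using h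
  | insert a T ha ih =>
    rw [Finset.insert_val_of_notMem ha] at h ⊢
    rw [Multiset.map_cons, Multiset.cons_add, ← Multiset.add_cons] at h
    have h1 := ih h (fun e he h hh => by
      rcases Multiset.mem_cons.1 he with rfl | he
      · simp [hx, hy] at hh
      · exact hr e he h hh)
    rw [Multiset.add_cons] at h1
    have h2 := h1.subdivide (r := (r, a)) (by simp [hx]) (by simp [hy]) (fun e he hh => by
      rw [Multiset.mem_add, Multiset.mem_add, Multiset.mem_map, Multiset.mem_map] at he
      rcases he with (⟨b, hb, rfl⟩ | ⟨b, hb, rfl⟩) | he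
      · simp only [Sym2.mem_iff, Prod.mk.injEq, hx, false_and, true_and, false_or] at hh
        exact ha (hh ▸ hb)
      · simp only [Sym2.mem_iff, Prod.mk.injEq, hy, false_and, true_and, or_false] at hh
        exact ha (hh ▸ hb)
      · exact hr e he a hh)
    simpa only [Multiset.map_cons, Multiset.cons_add, Multiset.add_cons,
      Multiset.cons_swap] using h2

lemma PathPartition.exists_extend_layers {v w : V} (hvw : v ≠ w) {E : Multiset (Sym2 (V × W))}
    {D : Multiset (V × W)} (h : PathPartition E D) (hw : ∀ h, (w, h) ∈ D)
    (hv : ∀ e ∈ E, ∀ h, (v, h) ∉ e) (T : Finset W)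
    (hnd : (E + T.val.map fun h => s((v, h), (w, h))).Nodup) :
    ∃ D', PathPartition (E + T.val.map fun h => s((v, h), (w, h))) D' ∧
      (∀ h ∈ T, (v, h) ∈ D') ∧ (∀ h ∉ T, (w, h) ∈ D') ∧
      Multiset.card D' = Multiset.card D := by
  classical
  induction T using Finset.induction_on with
  | empty => exact ⟨D, by simpa using h, by simp, fun h _ => hw h, rfl⟩
  | insert a T ha ih =>
    rw [Finset.insert_val_of_notMem ha, Multiset.map_cons, Multiset.add_cons] at hnd ⊢
    obtain ⟨D', hD', hvD, hwD, hcard⟩ := ih (Multiset.nodup_cons.1 hnd).2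
    obtain ⟨D₁, rfl⟩ := Multiset.exists_cons_of_mem (hwD a ha)
    refine ⟨(v, a) ::ₘ D₁, hD'.switch_of_fresh (by simp [hvw]) hnd ?_, ?_, ?_, by simpa using hcard⟩
    · intro e he hh
      rcases Multiset.mem_add.1 he with he | he
      · exact hv e he a hh
      · obtain ⟨b, hb, rfl⟩ := Multiset.mem_map.1 he
        simp only [Sym2.mem_iff, Prod.mk.injEq, hvw, false_and, true_and, or_false] at hh
        exact ha (hh ▸ hb)
    · intro h hh
      rcases Finset.mem_insert.1 hh with rfl | hh
      · simp
      · have := hvD h hh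
        simp only [Multiset.mem_cons, Prod.mk.injEq, hvw, false_and, false_or] at this
        exact Multiset.mem_cons_of_mem this
    · intro h hh
      rw [Finset.mem_insert, not_or] at hh
      have := hwD h hh.2
      simp only [Multiset.mem_cons, Prod.mk.injEq, hh.1, and_false, false_or] at this
      exact Multiset.mem_cons_of_mem this

variable [Fintype W] (H : SimpleGraph W) [DecidableRel H.Adj]

lemma notMem_of_mem_prodEdges_stepEdges {l : List V} {S : Multiset V} {v : V} (hl : v ∉ l)
    (hS : v ∉ S) {f : Sym2 (V × W)} (hf : f ∈ prodEdges H (l.stepEdges : Multiset _) S) (h : W) :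
    (v, h) ∉ f := fun hv => by
  rcases fst_of_mem_prodEdges H hf hv with h | ⟨e, he, h⟩
  · exact hS h
  · exact hl (List.mem_of_mem_stepEdges he h)

lemma List.not_isDiag_of_mem_stepEdges {X : Type*} {l : List X} (hl : l.Nodup) {e : Sym2 X}
    (he : e ∈ l.stepEdges) : ¬e.IsDiag := by
  induction l with
  | nil => simp at he
  | cons x l ih =>
    cases l with
    | nil => simp at he
    | cons y l =>
      rw [stepEdges_cons_cons, mem_cons] at he
      rcases he with rfl | he
      · rintro (rfl : x = y)
        simp at hl
      · exact ih hl.of_cons he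

lemma PathPartition.insert_unmarked {v c : V} (U l : List V) {S : Multiset V}
    {D : Multiset (V × W)}
    (h : PathPartition (prodEdges H ((v :: c :: l).stepEdges : Multiset _) S) D)
    (hnd : (v :: (U ++ c :: l)).Nodup) (hU : ∀ u ∈ U, u ∉ S) :
    PathPartition (prodEdges H ((v :: (U ++ c :: l)).stepEdges : Multiset _) S) D := by
  induction U with
  | nil => exact h
  | cons u U ih =>
    have h1 := ih (hnd.sublist (by simp)) fun x hx => hU x (List.mem_cons_of_mem _ hx)
    obtain ⟨y, l', hl'⟩ : ∃ y l', U ++ c :: l = y :: l' := by cases U <;> simp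
    rw [List.cons_append, hl'] at hnd ⊢
    rw [hl'] at h1
    rw [List.stepEdges_cons_cons, ← Multiset.cons_coe, prodEdges_cons_left, layerCopies_mk] at h1
    rw [List.stepEdges_cons_cons, List.stepEdges_cons_cons, ← Multiset.cons_coe,
      ← Multiset.cons_coe, prodEdges_cons_left, prodEdges_cons_left, layerCopies_mk,
      layerCopies_mk, ← add_assoc]
    have hnd' := hnd
    simp only [List.nodup_cons, List.mem_cons, not_or] at hnd'
    refine h1.subdivide_layers _ (Ne.symm hnd'.1.1) hnd'.2.1.1 fun e he h => ?_
    exact notMem_of_mem_prodEdges_stepEdges H (by simp [hnd'.2.1]) (hU u (by simp)) he h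

open Classical in
lemma exists_pathPartition_prodEdges_path (hH : H.Connected) (v : V) (l : List V)
    (hnd : (v :: l).Nodup) (S : Finset V) (hS : ∀ x ∈ S, x ∈ v :: l)
    (hlast : (v :: l).getLast (List.cons_ne_nil v l) ∈ S) (hcard : 2 ≤ S.card) :
    ∃ D, PathPartition (prodEdges H ((v :: l).stepEdges : Multiset _) S.val) D ∧
      (∀ h, (v, h) ∈ D) ∧ Multiset.card D ≤ S.card * Fintype.card W := by
  induction hn : l.length using Nat.strong_induction_on generalizing v l S with
  | _ n ih =>
  subst hn
  have hnodup : ∀ (l' : List V) (S' : Finset V), l'.Nodup →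
      (prodEdges H (l'.stepEdges : Multiset _) S'.val).Nodup := fun l' S' hl' =>
    nodup_prodEdges H (Multiset.coe_nodup.2 (List.nodup_stepEdges hl'))
      (fun e he => List.not_isDiag_of_mem_stepEdges hl' he) S'.nodup
  by_cases hv : v ∈ S
  · obtain ⟨x, hx⟩ : (S.erase v).Nonempty := by
      rw [← Finset.card_pos, Finset.card_erase_of_mem hv]; omega
    rw [Finset.mem_erase] at hx
    have hxl : x ∈ l := (List.mem_cons.1 (hS x hx.2)).resolve_left hx.1
    obtain ⟨c, U, l', rfl, hcS, hU⟩ : ∃ c U l', l = U ++ c :: l' ∧ c ∈ S ∧ ∀ u ∈ U, u ∉ S := by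
      obtain ⟨c, U, l', hU, hc, hl⟩ : ∃ c U l', (∀ u ∈ U, u ∉ S) ∧ c ∈ S ∧ l = U ++ c :: l' := by
        clear ih hS hlast hnd
        induction l with
        | nil => simp at hxl
        | cons y l ihl =>
          by_cases hy : y ∈ S
          · exact ⟨y, [], l, by simp, hy, rfl⟩
          · obtain ⟨c, U, l', hU, hc, rfl⟩ := ihl
              ((List.mem_cons.1 hxl).resolve_left fun h => hy (h ▸ hx.2))
            exact ⟨c, y :: U, l', by simpa [hy] using hU, hc, rfl⟩
      exact ⟨c, U, l', hl, hc, hU⟩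
    have hvc : v ≠ c := by
      rintro rfl
      simp at hnd
    have hsub : (v :: c :: l').Nodup := hnd.sublist (by simp)
    have hvl : v ∉ c :: l' := (List.nodup_cons.1 hsub).1
    suffices h : ∃ D, PathPartition (prodEdges H ((v :: c :: l').stepEdges : Multiset _) S.val) D ∧
        (∀ h, (v, h) ∈ D) ∧ Multiset.card D ≤ S.card * Fintype.card W by
      obtain ⟨D, hD, hvD, hcD⟩ := h
      exact ⟨D, hD.insert_unmarked H U l' hnd hU, hvD, hcD⟩
    have hSe : ∀ y ∈ S.erase v, y ∈ c :: l' := by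
      intro y hy
      rw [Finset.mem_erase] at hy
      have := hS y hy.2
      simp only [List.mem_cons, List.mem_append] at this ⊢
      rcases this with h | h | h
      · exact absurd h hy.1
      · exact absurd hy.2 (hU y h)
      · exact h
    have hsplit : prodEdges H ((v :: c :: l').stepEdges : Multiset _) S.val
        = prodEdges H ((c :: l').stepEdges : Multiset _) (S.erase v).val + columnEdges H v
          + layerCopies W s(v, c) := by
      rw [← Finset.insert_erase hv, Finset.insert_val_of_notMem (Finset.notMem_erase v S),
        Finset.erase_insert (Finset.notMem_erase v S), prodEdges_cons_right,
        List.stepEdges_cons_cons, ← Multiset.cons_coe, prodEdges_cons_left]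
      abel
    have hndv := hnodup _ S hsub
    rw [hsplit] at hndv ⊢
    by_cases h2 : 2 ≤ (S.erase v).card
    · have hlast' : (c :: l').getLast (List.cons_ne_nil _ _) ∈ S.erase v := by
        rw [Finset.mem_erase]
        refine ⟨fun h => hvl (h ▸ List.getLast_mem _), ?_⟩
        rwa [List.getLast_cons (by simp), List.getLast_append_of_ne_nil _ (by simp)] at hlast
      obtain ⟨D, hD, hcD, hDcard⟩ := ih l'.length (by simp; omega) c l'
        (List.nodup_cons.1 hsub).2 (S.erase v) hSe hlast' h2 rfl
      obtain ⟨D', hD', hvD, hcard'⟩ := hD.exists_attach_column H hH hvc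
        (fun e he h => notMem_of_mem_prodEdges_stepEdges H hvl (Finset.notMem_erase v S) he h) hcD
        (fun h hodd => by
          have hpar := hD.even_incidence_add_count (c, h)
          have hpos := Multiset.count_pos.2 (hcD h)
          have hinc : (prodEdges H ((c :: l').stepEdges : Multiset _)
              (S.erase v).val).incidence (c, h) = 1 + H.degree h := by
            have hcS' : c ∈ S.erase v := by simp [hvc.symm, hcS]
            obtain _ | ⟨y, l'⟩ := l'
            · have := Finset.card_le_card (t := {c}) fun x hx => by simpa using hSe x hx
              simp at this
              omega
            have hcy : c ∉ y :: l' := (List.nodup_cons.1 (List.nodup_cons.1 hsub).2).1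
            rw [← Finset.insert_erase hcS',
              Finset.insert_val_of_notMem (Finset.notMem_erase _ _), prodEdges_cons_right,
              List.stepEdges_cons_cons, ← Multiset.cons_coe, prodEdges_cons_left,
              Multiset.incidence_add, Multiset.incidence_add, incidence_columnEdges,
              layerCopies_mk, incidence_map_layer (fun h => hcy (by simp [h])),
              Multiset.incidence_eq_zero_iff.2 fun e he =>
                notMem_of_mem_prodEdges_stepEdges H hcy (Finset.notMem_erase c _) he h]
            simp [add_comm]
          rw [hinc] at hpar
          grind) hndv
      refine ⟨D', hD', hvD, hcard'.trans ?_⟩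
      rw [← Finset.card_erase_add_one hv, add_mul, one_mul]
      exact Nat.add_le_add_right hDcard _
    · have hSc : S.erase v = {c} := by
        have hcS' : c ∈ S.erase v := by simp [hvc.symm, hcS]
        refine (Finset.eq_of_subset_of_card_le (Finset.singleton_subset_iff.2 hcS') ?_).symm
        simp; omega
      obtain rfl : l' = [] := by
        by_contra hl'
        rw [List.getLast_cons (by simp), List.getLast_append_of_ne_nil _ (by simp),
          List.getLast_cons hl'] at hlast
        have hmem := List.getLast_mem hl'
        have : l'.getLast hl' ∈ S.erase v := Finset.mem_erase.2
          ⟨fun h => hvl (List.mem_cons_of_mem _ (h ▸ hmem)), hlast⟩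
        rw [hSc, Finset.mem_singleton] at this
        rw [this] at hmem
        exact (List.nodup_cons.1 (List.nodup_cons.1 hsub).2).1 hmem
      have heq : prodEdges H (([c] : List V).stepEdges : Multiset _) (S.erase v).val
          + columnEdges H v + layerCopies W s(v, c)
          = layerCopies W s(v, c) + (columnEdges H v + columnEdges H c) := by
        rw [hSc, Finset.singleton_val, ← Multiset.cons_zero, prodEdges_cons_right]
        simp only [List.stepEdges_singleton, Multiset.coe_nil, prodEdges, Multiset.zero_bind,
          add_zero]
        abel
      rw [heq] at hndv ⊢
      obtain ⟨D, hD, hvD, hDcard⟩ := exists_pathPartition_two_columns H hvc hndv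
      exact ⟨D, hD, hvD, hDcard.le.trans (Nat.mul_le_mul_right _ hcard)⟩
  · obtain _ | ⟨w, l⟩ := l
    · exact absurd (by simpa using hlast) hv
    have hvw : v ∉ w :: l := (List.nodup_cons.1 hnd).1
    obtain ⟨D, hD, hwD, hDcard⟩ := ih l.length (by simp) w l (List.nodup_cons.1 hnd).2 S
      (fun x hx => (List.mem_cons.1 (hS x hx)).resolve_left fun h => hv (h ▸ hx))
      (by rwa [List.getLast_cons (by simp)] at hlast) hcard rfl
    have hsplit : prodEdges H ((v :: w :: l).stepEdges : Multiset _) S.val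
        = prodEdges H ((w :: l).stepEdges : Multiset _) S.val + layerCopies W s(v, w) := by
      rw [List.stepEdges_cons_cons, ← Multiset.cons_coe, prodEdges_cons_left, add_comm]
    have hndv := hnodup _ S hnd
    rw [hsplit, layerCopies_mk] at hndv ⊢
    obtain ⟨D', hD', hvD, -, hcard'⟩ := hD.exists_extend_layers (fun h => hvw (by simp [h])) hwD
      (fun e he h => notMem_of_mem_prodEdges_stepEdges H hvw hv he h) Finset.univ hndv
    exact ⟨D', hD', fun h => hvD h (Finset.mem_univ h), hcard'.trans_le hDcard⟩

end PathTile

section Forest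

variable {V W : Type*}

namespace SimpleGraph

lemma Walk.edges_eq_stepEdges {G : SimpleGraph V} {a b : V} (p : G.Walk a b) :
    p.edges = p.support.stepEdges := by
  induction p with
  | nil => rfl
  | cons h p ih =>
    rw [edges_cons, support_cons, ih, ← cons_tail_support, List.stepEdges_cons_cons]

lemma Walk.IsTrail.even_incidence_edges_iff {G : SimpleGraph V} {a b : V} {p : G.Walk a b}
    (hp : p.IsTrail) (v : V) :
    Even ((p.edges : Multiset _).incidence v) ↔ (a ≠ b → v ≠ a ∧ v ≠ b) := by
  classical
  rw [← hp.even_countP_edges_iff, Multiset.incidence, Multiset.coe_countP]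

lemma Walk.incidence_edges_eq_zero {G : SimpleGraph V} {a b : V} {p : G.Walk a b} {v : V}
    (hv : v ∉ p.support) : (p.edges : Multiset _).incidence v = 0 := by
  rw [Multiset.incidence_eq_zero_iff]
  exact fun e he h => hv (p.mem_support_of_mem_edges he h)

variable [Fintype V] {G F : SimpleGraph V} {a b : V}

open Classical in
lemma Walk.IsTrail.exists_edgeFinset_eq_add {p : G.Walk a b} (hp : p.IsTrail) :
    ∃ F : SimpleGraph V, F ≤ G ∧ G.edgeFinset.val = (p.edges : Multiset _) + F.edgeFinset.val := by
  obtain ⟨F, hF⟩ : ∃ F, F = G.deleteEdges {e | e ∈ p.edges} := ⟨_, rfl⟩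
  refine ⟨F, hF ▸ deleteEdges_le _, ?_⟩
  have hnd : ((p.edges : Multiset _) + F.edgeFinset.val).Nodup := by
    rw [Multiset.nodup_add]
    refine ⟨Multiset.coe_nodup.2 hp.edges_nodup, Finset.nodup _, Multiset.disjoint_left.2 ?_⟩
    intro e he h
    rw [Finset.mem_val, mem_edgeFinset, hF, edgeSet_deleteEdges] at h
    exact h.2 he
  refine (Multiset.Nodup.ext (Finset.nodup _) hnd).2 fun e => ?_
  rw [Multiset.mem_add, Finset.mem_val, Finset.mem_val, mem_edgeFinset, mem_edgeFinset,
    hF, edgeSet_deleteEdges, Multiset.mem_coe]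
  refine ⟨fun h => ?_, fun h => ?_⟩
  · by_cases he : e ∈ p.edges
    · exact .inl he
    · exact .inr ⟨h, he⟩
  · rcases h with h | h
    · exact p.edges_subset_edgeSet h
    · exact h.1

open Classical in
lemma adj_iff_of_edgeFinset_eq_add {l : List (Sym2 V)}
    (hs : G.edgeFinset.val = (l : Multiset _) + F.edgeFinset.val) {x y : V} :
    F.Adj x y ↔ G.Adj x y ∧ s(x, y) ∉ l := by
  have hnd : G.edgeFinset.val.Nodup := Finset.nodup _
  have hmem : s(x, y) ∈ G.edgeFinset.val ↔ s(x, y) ∈ (l : Multiset _) + F.edgeFinset.val := by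
    rw [hs]
  rw [hs, Multiset.nodup_add] at hnd
  rw [Multiset.mem_add, Finset.mem_val, Finset.mem_val, mem_edgeFinset, mem_edgeFinset, mem_edgeSet,
    mem_edgeSet, Multiset.mem_coe] at hmem
  have hdisj : s(x, y) ∈ (l : Multiset _) → s(x, y) ∉ F.edgeFinset.val :=
    fun h => Multiset.disjoint_left.1 hnd.2.2 h
  rw [Finset.mem_val, mem_edgeFinset, mem_edgeSet, Multiset.mem_coe] at hdisj
  tauto

open Classical in
lemma degree_eq_of_edgeFinset_eq_add {l : List (Sym2 V)}
    (hs : G.edgeFinset.val = (l : Multiset _) + F.edgeFinset.val) (v : V) :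
    G.degree v = (l : Multiset _).incidence v + F.degree v := by
  rw [← Multiset.incidence_edgeFinset, hs, Multiset.incidence_add, Multiset.incidence_edgeFinset]

open Classical in
lemma IsAcyclic.exists_isPath_append (hF : F.IsAcyclic) {p : F.Walk a b} (hp : p.IsPath)
    (hnil : ¬p.Nil) : ∃ (e : V) (q : F.Walk b e), (p.append q).IsPath ∧ F.degree e = 1 := by
  induction hn : Fintype.card V - p.length using Nat.strong_induction_on generalizing b p with
  | _ n ih =>
  subst hn
  by_cases h : ∀ x, F.Adj b x → x = p.penultimate
  · refine ⟨b, .nil, by simpa using hp, ?_⟩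
    rw [degree_eq_one_iff_existsUnique_adj]
    exact ⟨p.penultimate, (p.adj_penultimate hnil).symm, h⟩
  · push Not at h
    obtain ⟨x, hx, hne⟩ := h
    have hxs : x ∉ p.support := fun h => hne (hF.eq_penultimate_of_adj_end hp hx h)
    have hpath : (p.concat hx).IsPath := hp.concat hxs hx
    have hlen := hp.length_lt
    obtain ⟨e, q, hq, he⟩ := ih (Fintype.card V - (p.concat hx).length)
      (by rw [Walk.length_concat]; omega) hpath (by simp [← Walk.length_eq_zero_iff]) rfl
    exact ⟨e, .cons hx q, by rwa [Walk.concat_append] at hq, he⟩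

end SimpleGraph

variable [Fintype W] (H : SimpleGraph W) [DecidableRel H.Adj]

/-- The layer copies of `E` and the columns over `S` can be partitioned into paths having together
at most `|S| * |W|` endpoints. -/
def IsTile (E : Multiset (Sym2 V)) (S : Finset V) : Prop :=
  ∃ D, PathPartition (prodEdges H E S.val) D ∧ Multiset.card D ≤ S.card * Fintype.card W

variable {H}

lemma IsTile.add {E₁ E₂ : Multiset (Sym2 V)} {S₁ S₂ S : Finset V} (h₁ : IsTile H E₁ S₁)
    (h₂ : IsTile H E₂ S₂) (hS : S₁.val + S₂.val = S.val) : IsTile H (E₁ + E₂) S := by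
  obtain ⟨D₁, hD₁, hc₁⟩ := h₁
  obtain ⟨D₂, hD₂, hc₂⟩ := h₂
  refine ⟨D₁ + D₂, ?_, ?_⟩
  · rw [← hS, prodEdges_add]
    exact hD₁.add hD₂
  · rw [Multiset.card_add, Finset.card, ← hS, Multiset.card_add, add_mul]
    exact Nat.add_le_add hc₁ hc₂

lemma SimpleGraph.Walk.IsPath.isTile {G : SimpleGraph V} {a b : V} {p : G.Walk a b}
    (hp : p.IsPath) (hH : H.Connected) {M : Finset V} (hM : ∀ x ∈ M, x ∈ p.support) (hb : b ∈ M)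
    (hcard : 2 ≤ M.card) : IsTile H (p.edges : Multiset _) M := by
  have hcons : p.support = a :: p.support.tail := p.cons_tail_support.symm
  have hnd := hp.support_nodup
  have hlast : p.support.getLast p.support_ne_nil ∈ M := by rwa [p.getLast_support]
  rw [p.edges_eq_stepEdges]
  revert hM hnd hlast
  generalize_proofs h1
  revert h1
  rw [hcons]
  intro _ hM hnd hlast
  obtain ⟨D, hD, -, hDcard⟩ :=
    exists_pathPartition_prodEdges_path H hH a p.support.tail hnd M hM hlast hcard
  exact ⟨D, hD, hDcard⟩

lemma Finset.val_add_sdiff_val [DecidableEq V] {M S : Finset V} (h : M ⊆ S) :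
    M.val + (S \ M).val = S.val := by
  rw [Finset.sdiff_val, add_tsub_cancel_of_le (Finset.val_le_iff.2 h)]

variable [Fintype V]

open Classical in
/-- The edges of a forest form a tile with any set of nonisolated vertices containing all vertices
of odd degree. -/
lemma SimpleGraph.IsAcyclic.isTile (hH : H.Connected) {F : SimpleGraph V} (hF : F.IsAcyclic)
    (S : Finset V) (hodd : ∀ v, Odd (F.degree v) → v ∈ S) (hpos : ∀ v ∈ S, F.degree v ≠ 0) :
    IsTile H F.edgeFinset.val S := by
  induction hn : F.edgeFinset.card using Nat.strong_induction_on generalizing F S with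
  | _ n ih =>
  subst hn
  by_cases hbot : ∃ u v, F.Adj u v
  · obtain ⟨u, v, huv⟩ := hbot
    obtain ⟨a, q, hq, ha⟩ := hF.exists_isPath_append (p := huv.toWalk) (by simp [huv.ne]) (by simp)
    obtain ⟨b, q', hp, hb⟩ := hF.exists_isPath_append hq.reverse (by simp)
    set p := (huv.toWalk.append q).reverse.append q' with hpdef
    have hnil : ¬p.Nil := by simp [hpdef]
    have hab : a ≠ b := fun h => by
      subst h
      exact hnil (Walk.isPath_iff_nil.1 hp)
    obtain ⟨F', hF', hs⟩ := hp.isTrail.exists_edgeFinset_eq_add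
    have hdeg := degree_eq_of_edgeFinset_eq_add hs
    have heven := hp.isTrail.even_incidence_edges_iff
    have hend : ∀ x, ¬Even ((p.edges : Multiset _).incidence x) → F.degree x = 1 →
        F'.degree x = 0 := by
      intro x hx h1
      have := hdeg x
      grind
    have hva : F'.degree a = 0 := hend a (by simp [heven, hab]) ha
    have hvb : F'.degree b = 0 := hend b (by simp [heven, hab]) hb
    set M := S.filter fun x => F'.degree x = 0 with hM
    have hMa : a ∈ M := by simp [hM, hva, hodd a (by rw [ha]; exact odd_one)]
    have hMb : b ∈ M := by simp [hM, hvb, hodd b (by rw [hb]; exact odd_one)]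
    rw [hs]
    refine (hp.isTile hH ?_ hMb (Finset.one_lt_card.2 ⟨a, hMa, b, hMb, hab⟩)).add
      (ih _ ?_ (hF.anti hF') (S \ M) ?_ ?_ rfl)
      (Finset.val_add_sdiff_val (Finset.filter_subset _ _))
    · intro x hx
      rw [hM, Finset.mem_filter] at hx
      by_contra hxp
      exact hpos x hx.1 (by rw [hdeg, Walk.incidence_edges_eq_zero hxp, hx.2])
    · rw [Finset.card, Finset.card, hs, Multiset.card_add, Multiset.coe_card, Walk.length_edges]
      have := mt Walk.length_eq_zero_iff.1 hnil
      omega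
    · intro x hx
      have hx0 : F'.degree x ≠ 0 := fun h => by simp [h] at hx
      have hxa : x ≠ a := fun h => hx0 (h ▸ hva)
      have hxb : x ≠ b := fun h => hx0 (h ▸ hvb)
      rw [Finset.mem_sdiff, hM, Finset.mem_filter, not_and]
      refine ⟨hodd x ?_, fun _ => hx0⟩
      rw [hdeg]
      exact ((heven x).2 fun _ => ⟨hxa, hxb⟩).add_odd hx
    · intro x hx h0
      rw [Finset.mem_sdiff, hM, Finset.mem_filter, not_and] at hx
      exact hx.2 hx.1 h0
  · push Not at hbot
    have hbot' : F = ⊥ := by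
      ext u v
      simp [hbot u v]
    have hS : S = ∅ := by
      rw [Finset.eq_empty_iff_forall_notMem]
      refine fun v hv => hpos v hv ?_
      rw [degree_eq_zero_iff_notMem_support, mem_support]
      simpa using hbot v
    have hE : F.edgeFinset = ∅ := by
      rw [Finset.eq_empty_iff_forall_notMem]
      intro e he
      induction e with
      | h x y => exact hbot x y (by simpa using he)
    rw [hS, hE]
    exact ⟨0, by simpa [prodEdges] using pathPartition_zero (X := V × W) 0, by simp⟩

variable {G F : SimpleGraph V}

open Classical in
lemma isTile_univ_of_even_even (hH : H.Connected) (hG : ∀ v, G.degree v ≠ 0) {s t z : V}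
    {P : G.Walk s t} (hP : P.IsPath) (hF : F.IsAcyclic)
    (hs : G.edgeFinset.val = (P.edges : Multiset _) + F.edgeFinset.val) (hz : z ∈ P.support)
    (hzs : z ≠ s) (hds : Even (F.degree s)) (hdz : Even (F.degree z)) :
    IsTile H G.edgeFinset.val Finset.univ := by
  set M : Finset V := insert s (insert z (Finset.univ.filter fun v => F.degree v = 0)) with hM
  have hsM : s ∈ M := by simp [hM]
  have hzM : z ∈ M := by simp [hM]
  rw [hs]
  refine IsTile.add ?_ (hF.isTile hH (Finset.univ \ M) ?_ ?_)
    (Finset.val_add_sdiff_val (Finset.subset_univ _))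
  · rw [← Multiset.coe_reverse, ← Walk.edges_reverse]
    refine hP.reverse.isTile hH ?_ hsM (Finset.one_lt_card.2 ⟨z, hzM, s, hsM, hzs⟩)
    intro x hx
    rw [Walk.support_reverse, List.mem_reverse]
    simp only [hM, Finset.mem_insert, Finset.mem_filter, Finset.mem_univ, true_and] at hx
    rcases hx with rfl | rfl | hx
    · exact P.start_mem_support
    · exact hz
    · by_contra hxp
      exact hG x (by
        rw [degree_eq_of_edgeFinset_eq_add hs, Walk.incidence_edges_eq_zero hxp, hx])
  · intro v hv
    simp only [hM, Finset.mem_sdiff, Finset.mem_insert, Finset.mem_filter, Finset.mem_univ,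
      true_and]
    rintro (rfl | rfl | h)
    · exact Nat.not_even_iff_odd.2 hv hds
    · exact Nat.not_even_iff_odd.2 hv hdz
    · simp [h] at hv
  · intro v hv h0
    simp [hM, h0] at hv

open Classical in
lemma isTile_univ_of_even_nbr (hH : H.Connected) (hG : ∀ v, G.degree v ≠ 0) {d t z y : V}
    {P : G.Walk d t} (hP : P.IsPath) (hF : F.IsAcyclic)
    (hs : G.edgeFinset.val = (P.edges : Multiset _) + F.edgeFinset.val) (hz : z ∈ P.support)
    (hzd : z ≠ d) (hdd : Odd (F.degree d)) (hdz : Even (F.degree z)) (hdy : F.Adj d y)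
    (hyz : y ≠ z) (hy : Even (F.degree y)) : IsTile H G.edgeFinset.val Finset.univ := by
  set M : Finset V := insert d (insert z (Finset.univ.filter fun v => F.degree v = 0)) with hM
  have hdM : d ∈ M := by simp [hM]
  have hzM : z ∈ M := by simp [hM]
  obtain ⟨e, q, hL, he⟩ := hF.exists_isPath_append (p := hdy.toWalk) (by simp [hdy.ne]) (by simp)
  set L := hdy.toWalk.append q with hLdef
  have hde : d ≠ e := fun h => by
    subst h
    have : L.Nil := Walk.isPath_iff_nil.1 hL
    simp [hLdef] at this
  have hye : y ≠ e := by
    rintro rfl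
    rw [he] at hy
    exact Nat.not_even_one hy
  have hyL : y ∈ L.support := by simp [hLdef]
  obtain ⟨K, hK, hsK⟩ := hL.isTrail.exists_edgeFinset_eq_add
  have hdeg := degree_eq_of_edgeFinset_eq_add hsK
  have heven := hL.isTrail.even_incidence_edges_iff
  have hKe : K.degree e = 0 := by
    have h1 := hdeg e
    have h2 : ¬Even ((L.edges : Multiset _).incidence e) := by simp [heven, hde]
    grind
  have hdy0 : F.degree y ≠ 0 := by
    rw [← Nat.pos_iff_ne_zero, degree_pos_iff_exists_adj]
    exact ⟨d, hdy.symm⟩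
  have hyM : y ∉ M := by simp [hM, hdy.ne', hyz, hdy0]
  have heM : e ∉ M := by
    simp only [hM, Finset.mem_insert, Finset.mem_filter, Finset.mem_univ, true_and, not_or]
    refine ⟨hde.symm, ?_, by omega⟩
    rintro rfl
    rw [he] at hdz
    exact Nat.not_even_one hdz
  set N : Finset V := insert y ((Finset.univ \ M).filter fun v => K.degree v = 0) with hN
  have hyN : y ∈ N := by simp [hN]
  have heN : e ∈ N := by simp [hN, hKe, heM]
  have hNM : N ⊆ Finset.univ \ M := by
    rw [hN, Finset.insert_subset_iff]
    exact ⟨by simp [hyM], Finset.filter_subset _ _⟩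
  rw [hs]
  refine IsTile.add (S₁ := M) (S₂ := Finset.univ \ M) ?_ ?_
    (Finset.val_add_sdiff_val (Finset.subset_univ _))
  · rw [← Multiset.coe_reverse, ← Walk.edges_reverse]
    refine hP.reverse.isTile hH ?_ hdM (Finset.one_lt_card.2 ⟨z, hzM, d, hdM, hzd⟩)
    intro x hx
    rw [Walk.support_reverse, List.mem_reverse]
    simp only [hM, Finset.mem_insert, Finset.mem_filter, Finset.mem_univ, true_and] at hx
    rcases hx with rfl | rfl | hx
    · exact P.start_mem_support
    · exact hz
    · by_contra hxp
      exact hG x (by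
        rw [degree_eq_of_edgeFinset_eq_add hs, Walk.incidence_edges_eq_zero hxp, hx])
  · rw [hsK]
    refine (hL.isTile hH ?_ heN (Finset.one_lt_card.2 ⟨y, hyN, e, heN, hye⟩)).add
      ((hF.anti hK).isTile hH ((Finset.univ \ M) \ N) ?_ ?_) (Finset.val_add_sdiff_val hNM)
    · intro x hx
      rw [hN, Finset.mem_insert, Finset.mem_filter] at hx
      rcases hx with rfl | hx
      · exact hyL
      · by_contra hxL
        have h1 := hx.1
        simp [hM, hdeg x, Walk.incidence_edges_eq_zero hxL, hx.2] at h1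
    · intro v hv
      have hv0 : K.degree v ≠ 0 := fun h => by simp [h] at hv
      have hve : v ≠ e := fun h => hv0 (h ▸ hKe)
      have hvd : v ≠ d := by
        rintro rfl
        have h1 := hdeg v
        have h2 : ¬Even ((L.edges : Multiset _).incidence v) := by simp [heven, hde]
        grind
      have hvF : Odd (F.degree v) := by
        rw [hdeg]
        exact ((heven v).2 fun _ => ⟨hvd, hve⟩).add_odd hv
      have hvF0 : F.degree v ≠ 0 := fun h => by simp [h] at hvF
      simp only [hM, hN, Finset.mem_sdiff, Finset.mem_insert, Finset.mem_filter, Finset.mem_univ,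
        true_and, hv0, hvd, hvF0, and_false, or_false, false_or]
      exact ⟨fun h => Nat.not_even_iff_odd.2 (h ▸ hvF) hdz,
        fun h => Nat.not_even_iff_odd.2 (h ▸ hvF) hy⟩
    · intro v hv h0
      rw [Finset.mem_sdiff, hN, Finset.mem_insert, Finset.mem_filter] at hv
      exact hv.2 (.inr ⟨hv.1, h0⟩)

open Classical in
lemma isTile_univ_of_even_degree (hH : H.Connected) (hG : ∀ v, G.degree v ≠ 0) {d t z : V}
    {P : G.Walk d t} (hP : P.IsPath) (hF : F.IsAcyclic)
    (hs : G.edgeFinset.val = (P.edges : Multiset _) + F.edgeFinset.val) (hz : z ∈ P.support)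
    (hzd : z ≠ d) (hdz : Even (F.degree z))
    (hd : Odd (F.degree d) → ∃ y ∉ P.support, F.Adj d y) :
    IsTile H G.edgeFinset.val Finset.univ := by
  by_cases hdd : Even (F.degree d)
  · exact isTile_univ_of_even_even hH hG hP hF hs hz hzd hdd hdz
  rw [Nat.not_even_iff_odd] at hdd
  obtain ⟨y, hyP, hdy⟩ := hd hdd
  have hyz : y ≠ z := fun h => hyP (h ▸ hz)
  by_cases hy : Even (F.degree y)
  · exact isTile_univ_of_even_nbr hH hG hP hF hs hz hzd hdd hdz hdy hyz hy
  obtain ⟨K, hK, hsK⟩ := (show hdy.symm.toWalk.IsTrail by simp).exists_edgeFinset_eq_add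
  have hdeg := degree_eq_of_edgeFinset_eq_add hsK
  have hKy : F.degree y = 1 + K.degree y := by
    rw [hdeg]
    congr 1
    simp [← Multiset.cons_zero, Multiset.incidence_cons_of_mem]
  have hKz : F.degree z = K.degree z := by
    rw [hdeg, Walk.incidence_edges_eq_zero, zero_add]
    simp [hyz.symm, hzd]
  have hydG : G.Adj y d := ((adj_iff_of_edgeFinset_eq_add hs).1 hdy.symm).1
  refine isTile_univ_of_even_even hH hG (P := .cons hydG P) (F := K) (s := y) (z := z)
    (hP.cons hyP) (hF.anti hK) ?_ ?_ hyz.symm ?_ ?_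
  · rw [hs, hsK, Walk.edges_cons, ← Multiset.cons_coe]
    simp [← Multiset.cons_coe]
  · simp [hz]
  · grind
  · rwa [← hKz]

end Forest

section Cotree

variable {V : Type*} {G T : SimpleGraph V} {a b c d : V}

namespace SimpleGraph

/-- Deleting the two distinct edges `ab` and `cd` of `G` leaves the connected graph `T`. -/
structure IsCotreePair (G T : SimpleGraph V) (a b c d : V) : Prop where
  adj_left : G.Adj a b
  adj_right : G.Adj c d
  ne : s(a, b) ≠ s(c, d)
  adj_iff : ∀ x y, T.Adj x y ↔ G.Adj x y ∧ s(x, y) ≠ s(a, b) ∧ s(x, y) ≠ s(c, d)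
  connected : T.Connected

lemma Connected.of_forall_adj_reachable {T' : SimpleGraph V} (hT : T.Connected)
    (h : ∀ x y, T.Adj x y → T'.Reachable x y) : T'.Connected := by
  have := hT.nonempty
  refine ⟨fun x y => ?_⟩
  obtain ⟨p⟩ := hT.preconnected x y
  induction p with
  | nil => rfl
  | cons hxy p ih => exact (h _ _ hxy).trans ih

lemma Walk.reachable_deleteEdges {x y u : V} (p : T.Walk x y) (hu : u ∉ p.support) (w : V) :
    (T.deleteEdges {s(u, w)}).Reachable x y :=
  ⟨p.toDeleteEdge _ fun h => hu (p.fst_mem_support_of_mem_edges h)⟩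

lemma Reachable.or_deleteEdges {x y u : V} (h : T.Reachable u y) :
    (T.deleteEdges {s(x, y)}).Reachable u x ∨ (T.deleteEdges {s(x, y)}).Reachable u y := by
  obtain ⟨p⟩ := h
  induction p with
  | nil => exact .inr .rfl
  | @cons u v y huv p ih =>
    by_cases he : s(u, v) = s(x, y)
    · rw [Sym2.eq_iff] at he
      rcases he with ⟨rfl, -⟩ | ⟨rfl, -⟩
      · exact .inl .rfl
      · exact .inr .rfl
    · have huv' : (T.deleteEdges {s(x, y)}).Adj u v := by simp [deleteEdges_adj, huv, he]
      exact ih.imp huv'.reachable.trans huv'.reachable.trans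

namespace IsCotreePair

lemma symm (h : IsCotreePair G T a b c d) : IsCotreePair G T d c b a where
  adj_left := h.adj_right.symm
  adj_right := h.adj_left.symm
  ne := by rw [Sym2.eq_swap, @Sym2.eq_swap V b a]; exact h.ne.symm
  adj_iff x y := by
    rw [@Sym2.eq_swap V b a, @Sym2.eq_swap V d c, and_comm (a := s(x, y) ≠ s(c, d))]
    exact h.adj_iff x y
  connected := h.connected

lemma swap_left (h : IsCotreePair G T a b c d) : IsCotreePair G T b a c d where
  adj_left := h.adj_left.symm
  adj_right := h.adj_right
  ne := by rw [@Sym2.eq_swap V b a]; exact h.ne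
  adj_iff := by rw [@Sym2.eq_swap V b a]; exact h.adj_iff
  connected := h.connected

lemma swap_right (h : IsCotreePair G T a b c d) : IsCotreePair G T a b d c :=
  h.symm.swap_left.symm

lemma le (h : IsCotreePair G T a b c d) : T ≤ G := fun x y hxy => ((h.adj_iff x y).1 hxy).1

lemma not_adj_left (h : IsCotreePair G T a b c d) : ¬T.Adj a b :=
  fun hab => ((h.adj_iff a b).1 hab).2.1 rfl

lemma exchange (h : IsCotreePair G T a b c d) {x y : V} (hxy : T.Adj x y)
    (hx : (T.deleteEdges {s(x, y)}).Reachable x a)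
    (hy : (T.deleteEdges {s(x, y)}).Reachable b y) :
    ∃ T', T.deleteEdges {s(x, y)} ≤ T' ∧ IsCotreePair G T' x y c d := by
  have hxy' := (h.adj_iff x y).1 hxy
  obtain ⟨T', hT'⟩ : ∃ T' : SimpleGraph V, ∀ u v,
      T'.Adj u v ↔ G.Adj u v ∧ s(u, v) ≠ s(x, y) ∧ s(u, v) ≠ s(c, d) :=
    ⟨G.deleteEdges {s(x, y), s(c, d)}, fun u v => by simp [deleteEdges_adj]⟩
  have hle : T.deleteEdges {s(x, y)} ≤ T' := by
    intro u v huv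
    rw [deleteEdges_adj, h.adj_iff] at huv
    rw [hT']
    exact ⟨huv.1.1, huv.2, huv.1.2.2⟩
  refine ⟨T', hle, hxy'.1, h.adj_right, hxy'.2.2, hT', ?_⟩
  have hab : T'.Adj a b := (hT' a b).2 ⟨h.adj_left, hxy'.2.1.symm, h.ne⟩
  have hr : T'.Reachable x y := (hx.mono hle).trans (hab.reachable.trans (hy.mono hle))
  refine h.connected.of_forall_adj_reachable fun u v huv => ?_
  by_cases he : s(u, v) = s(x, y)
  · rw [Sym2.eq_iff] at he
    rcases he with ⟨rfl, rfl⟩ | ⟨rfl, rfl⟩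
    · exact hr
    · exact hr.symm
  · exact (hle (by simpa [deleteEdges_adj, he] using huv)).reachable

lemma exists_not_adj (h : IsCotreePair G T a b b d) (hT : T.IsAcyclic) (had : T.Adj a d)
    (hr : (T.deleteEdges {s(a, d)}).Reachable b d) :
    ∃ z T', IsCotreePair G T' a b b z ∧ ¬T'.Adj a z := by
  classical
  obtain ⟨r, hr⟩ := hr.exists_isPath
  cases r with
  | nil => exact absurd h.adj_right (G.loopless.irrefl _)
  | @cons _ z _ hbz r =>
    rw [Walk.cons_isPath_iff] at hr
    have hbz' : T.Adj b z := (deleteEdges_le _ hbz)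
    have hzd : (T.deleteEdges {s(z, b)}).Reachable z d := by
      rw [Sym2.eq_swap]
      exact (r.mapLe (deleteEdges_le _)).reachable_deleteEdges
        (by simpa [Walk.support_mapLe_eq_support] using hr.2) z
    obtain ⟨T', -, h'⟩ := h.symm.exchange hbz'.symm hzd .rfl
    refine ⟨z, T', h'.symm, fun haz => ?_⟩
    have hne : z ≠ d := by
      rintro rfl
      exact h.symm.not_adj_left hbz'.symm
    have haz' : T.Adj a z := by
      refine (h.adj_iff a z).2 ⟨h'.le haz, ?_, ?_⟩
      · exact fun he => ((h'.adj_iff a z).1 haz).2.2 (by rw [he, Sym2.eq_swap])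
      · rw [Ne, Sym2.eq_iff]
        rintro (⟨rfl, -⟩ | ⟨-, rfl⟩)
        · exact G.loopless.irrefl _ h.adj_left
        · exact G.loopless.irrefl _ h'.adj_left
    have hstep : (T.deleteEdges {s(a, d)}).Adj a z := by
      rw [deleteEdges_adj, Set.mem_singleton_iff, Sym2.congr_right]
      exact ⟨haz', hne⟩
    exact isBridge_iff.1 (isAcyclic_iff_forall_adj_isBridge.1 hT had)
      (hstep.reachable.trans r.reachable)

lemma isAcyclic [Fintype V] [Fintype G.edgeSet] (h : IsCotreePair G T a b c d)
    (hsize : G.edgeFinset.card = Fintype.card V + 1) : T.IsAcyclic := by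
  classical
  refine (isTree_iff_connected_and_card.2 ⟨h.connected, ?_⟩).isAcyclic
  have hE : G.edgeFinset = insert s(a, b) (insert s(c, d) T.edgeFinset) := by
    ext e
    induction e with
    | h x y =>
      have h1 : s(x, y) = s(a, b) → G.Adj x y := fun he => by
        rw [← mem_edgeSet, he]; exact h.adj_left
      have h2 : s(x, y) = s(c, d) → G.Adj x y := fun he => by
        rw [← mem_edgeSet, he]; exact h.adj_right
      simp only [mem_edgeFinset, Finset.mem_insert, mem_edgeSet, h.adj_iff]
      tauto
  rw [hE, Finset.card_insert_of_notMem, Finset.card_insert_of_notMem] at hsize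
  · rw [Nat.card_eq_fintype_card, Nat.card_eq_fintype_card, ← edgeFinset_card]
    omega
  · simpa using h.symm.swap_left.not_adj_left
  · simpa [h.ne] using h.not_adj_left

lemma notMem_support_of_forall_dist_le (h : IsCotreePair G T a b c d)
    (hmin : ∀ T' a' b' c' d', IsCotreePair G T' a' b' c' d' → T.dist b c ≤ T'.dist b' c')
    {q : T.Walk b c} (hq : q.length = T.dist b c) :
    a ∉ q.support ∧ ∀ v ∈ q.support, ¬T.Adj a v := by
  classical
  have ha : a ∉ q.support := fun ha => by
    have h1 := hmin _ _ _ _ _ h.swap_left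
    have h2 := dist_le (q.dropUntil a ha)
    have h3 := q.length_dropUntil_lt_length ha h.adj_left.ne
    omega
  refine ⟨ha, fun v hv hav => ?_⟩
  have h1 := (q.takeUntil v hv).reachable_deleteEdges
    (fun h => ha (q.support_takeUntil_subset_support hv h)) v
  obtain ⟨T', hle, h'⟩ := h.exchange hav .rfl h1
  have h2 := hmin _ _ _ _ _ h'
  have hvb : v ≠ b := by
    rintro rfl
    exact h.not_adj_left hav
  have h3 := q.length_dropUntil_lt_length hv hvb
  have h4 := dist_le (((q.dropUntil v hv).toDeleteEdge s(a, v) fun h => ha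
    (q.support_dropUntil_subset_support hv (Walk.fst_mem_support_of_mem_edges _ h))).mapLe hle)
  rw [Walk.length_mapLe] at h4
  have h5 : ((q.dropUntil v hv).toDeleteEdge s(a, v) fun h => ha
    (q.support_dropUntil_subset_support hv (Walk.fst_mem_support_of_mem_edges _ h))).length
      = (q.dropUntil v hv).length := Walk.length_transfer ..
  omega

end IsCotreePair

lemma Connected.exists_adj_not_isBridge [Fintype V] [Fintype G.edgeSet] (hG : G.Connected)
    (hsize : Fintype.card V ≤ G.edgeFinset.card) : ∃ x y, G.Adj x y ∧ ¬G.IsBridge s(x, y) := by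
  by_contra! h
  have := (IsTree.mk hG (isAcyclic_iff_forall_adj_isBridge.2 h)).card_edgeFinset
  omega

lemma Connected.exists_isCotreePair [Fintype V] [Fintype G.edgeSet] (hG : G.Connected)
    (hsize : G.edgeFinset.card = Fintype.card V + 1) : ∃ T a b c d, IsCotreePair G T a b c d := by
  classical
  obtain ⟨a, b, hab, hb⟩ := hG.exists_adj_not_isBridge (by omega)
  have hG' := hG.connected_delete_edge_of_not_isBridge hb
  obtain ⟨c, d, hcd, hb'⟩ := hG'.exists_adj_not_isBridge (by
    have hE : G.edgeFinset = insert s(a, b) (G.deleteEdges {s(a, b)}).edgeFinset := by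
      ext e
      by_cases he : e = s(a, b) <;> simp [he, hab]
    rw [hE, Finset.card_insert_of_notMem (by simp)] at hsize
    omega)
  rw [deleteEdges_adj, Set.mem_singleton_iff] at hcd
  refine ⟨_, a, b, c, d, hab, hcd.1, Ne.symm hcd.2, fun x y => ?_,
    hG'.connected_delete_edge_of_not_isBridge hb'⟩
  simp only [deleteEdges_adj, Set.mem_singleton_iff]
  tauto

/-- A bicyclic graph is a spanning tree `T` together with two edges `ab` and `cd`, which can be
chosen so that `a`, `d` and the path of `T` from `b` to `c` are far from each other in `T`. -/
lemma Connected.exists_isCotreePair_not_adj [Fintype V] [Fintype G.edgeSet] (hG : G.Connected)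
    (hsize : G.edgeFinset.card = Fintype.card V + 1) :
    ∃ T a b c d, IsCotreePair G T a b c d ∧ T.IsAcyclic ∧ a ≠ d ∧ ¬T.Adj a d ∧
      ∃ q : T.Walk b c, q.IsPath ∧ a ∉ q.support ∧ d ∉ q.support ∧
        (∀ v ∈ q.support, ¬T.Adj a v) ∧ ∀ v ∈ q.support, ¬T.Adj d v := by
  classical
  obtain ⟨T, a, b, c, d, h, hmin⟩ : ∃ T a b c d, IsCotreePair G T a b c d ∧
      ∀ T' a' b' c' d', IsCotreePair G T' a' b' c' d' → T.dist b c ≤ T'.dist b' c' := by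
    have hex : ∃ n T a b c d, IsCotreePair G T a b c d ∧ T.dist b c = n := by
      obtain ⟨T, a, b, c, d, h⟩ := hG.exists_isCotreePair hsize
      exact ⟨_, T, a, b, c, d, h, rfl⟩
    obtain ⟨T, a, b, c, d, h, hn⟩ := Nat.find_spec hex
    refine ⟨T, a, b, c, d, h, fun T' a' b' c' d' h' => ?_⟩
    rw [hn]
    exact Nat.find_min' hex ⟨T', a', b', c', d', h', rfl⟩
  have hT := h.isAcyclic hsize
  obtain ⟨q, hq, hlen⟩ := h.connected.exists_path_of_dist b c
  obtain ⟨ha, hav⟩ := h.notMem_support_of_forall_dist_le hmin hlen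
  by_cases had : T.Adj a d
  · have hzero : T.dist b c = 0 := by
      rcases (h.connected.preconnected b d).or_deleteEdges (x := a) with hb | hb
      · have hc := (q.reachable_deleteEdges ha d).symm.trans hb
        rw [Sym2.eq_swap] at hc
        obtain ⟨T', -, h'⟩ := h.symm.exchange had.symm .rfl hc
        simpa using hmin _ _ _ _ _ h'.symm.swap_left
      · obtain ⟨T', -, h'⟩ := h.exchange had .rfl hb
        simpa using hmin _ _ _ _ _ h'.swap_right
    obtain rfl := h.connected.dist_eq_zero_iff.1 hzero
    obtain ⟨T', a', d', h', hnot⟩ : ∃ T' a' d', IsCotreePair G T' a' b b d' ∧ ¬T'.Adj a' d' := by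
      rcases (h.connected.preconnected b d).or_deleteEdges (x := a) with hb | hb
      · rw [Sym2.eq_swap] at hb
        obtain ⟨z, T', h', hz⟩ := h.symm.exists_not_adj hT had.symm hb
        exact ⟨T', z, d, h'.symm, fun hzd => hz hzd.symm⟩
      · obtain ⟨z, T', h', hz⟩ := h.exists_not_adj hT had hb
        exact ⟨T', a, z, h', hz⟩
    refine ⟨T', a', b, b, d', h', h'.isAcyclic hsize, ?_, hnot, .nil, .nil, ?_, ?_, ?_, ?_⟩
    · rintro rfl
      exact h'.ne Sym2.eq_swap
    · simpa using h'.adj_left.ne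
    · simpa using h'.adj_right.ne'
    · simpa using h'.not_adj_left
    · simpa using h'.symm.not_adj_left
  · obtain ⟨hd, hdv⟩ := h.symm.notMem_support_of_forall_dist_le
      (by simpa only [T.dist_comm (u := c)] using hmin) (q := q.reverse)
      (by rw [Walk.length_reverse, hlen, dist_comm])
    simp only [Walk.support_reverse, List.mem_reverse] at hd hdv
    refine ⟨T, a, b, c, d, h, hT, ?_, had, q, hq, ha, hd, hav, hdv⟩
    rintro rfl
    have hzero : T.dist b c = 0 := by simpa using hmin _ _ _ _ _ h.swap_left.swap_right
    obtain rfl := h.connected.dist_eq_zero_iff.1 hzero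
    exact h.ne Sym2.eq_swap

lemma IsAcyclic.eq_of_adj_of_mem_support (hT : T.IsAcyclic) {q : T.Walk b c} {x u v : V}
    (hx : x ∉ q.support) (hu : u ∈ q.support) (hv : v ∈ q.support) (hxu : T.Adj x u)
    (hxv : T.Adj x v) : u = v := by
  classical
  set p := ((q.takeUntil u hu).reverse.append (q.takeUntil v hv)).bypass with hp
  have hxp : x ∉ p.support := fun h => by
    have h1 := Walk.support_bypass_subset_support _ h
    rw [Walk.mem_support_append_iff, Walk.support_reverse, List.mem_reverse] at h1
    exact h1.elim (fun h => hx (q.support_takeUntil_subset_support hu h))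
      fun h => hx (q.support_takeUntil_subset_support hv h)
  have hpath : (p.concat hxv.symm).IsPath := (Walk.bypass_isPath _).concat hxp hxv.symm
  simpa using hT.eq_penultimate_of_adj_end hpath hxu (by simp)

end SimpleGraph

end Cotree

section Bicyclic

namespace SimpleGraph

lemma exists_isPath_of_stepEdges_subset {X : Type*} {K : SimpleGraph X} {l : List X} (hne : l ≠ [])
    (hnd : l.Nodup) (hl : ∀ e ∈ l.stepEdges, e ∈ K.edgeSet) :
    ∃ p : Σ u v : X, K.Walk u v, p.2.2.IsPath ∧ p.2.2.edges = l.stepEdges := by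
  have hchain : l.IsChain K.Adj := by
    clear hne hnd
    induction l with
    | nil => simp
    | cons x l ih =>
      cases l with
      | nil => simp
      | cons y l =>
        rw [List.stepEdges_cons_cons, List.forall_mem_cons] at hl
        exact List.isChain_cons_cons.2 ⟨hl.1, ih hl.2⟩
  refine ⟨⟨_, _, Walk.ofSupport l hne hchain⟩, ?_, ?_⟩
  · rwa [Walk.isPath_def, Walk.support_ofSupport]
  · rw [Walk.edges_eq_stepEdges, Walk.support_ofSupport]

lemma exists_list_walk {X : Type*} {K : SimpleGraph X} {P : Multiset (List X)}
    (hP : ∀ l ∈ P, l ≠ [] ∧ l.Nodup) (hK : ∀ l ∈ P, ∀ e ∈ l.stepEdges, e ∈ K.edgeSet) :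
    ∃ Q : List (Σ u v : X, K.Walk u v), Q.length = Multiset.card P ∧ (∀ p ∈ Q, p.2.2.IsPath) ∧
      ((Q.flatMap fun p => p.2.2.edges : List _) : Multiset (Sym2 X))
        = P.bind fun l => (l.stepEdges : Multiset (Sym2 X)) := by
  induction P using Multiset.induction_on with
  | empty => exact ⟨[], by simp⟩
  | cons l P ih =>
    rw [Multiset.forall_mem_cons] at hP hK
    obtain ⟨Q, hlen, hpath, hQ⟩ := ih hP.2 hK.2
    obtain ⟨p, hp, hpl⟩ := exists_isPath_of_stepEdges_subset hP.1.1 hP.1.2 hK.1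
    refine ⟨p :: Q, by simp [hlen], List.forall_mem_cons.2 ⟨hp, hpath⟩, ?_⟩
    rw [List.flatMap_cons, ← Multiset.coe_add, hQ, hpl, Multiset.cons_bind]

end SimpleGraph

lemma PathPartition.two_mul_pathNumber_le {X : Type*} {K : SimpleGraph X} {E : Multiset (Sym2 X)}
    {D : Multiset X} (h : PathPartition E D) (hE : E.Nodup) (hK : ∀ e, e ∈ E ↔ e ∈ K.edgeSet) :
    2 * K.pathNumber ≤ Multiset.card D := by
  obtain ⟨P, hP, rfl, rfl⟩ := h
  obtain ⟨Q, hlen, hpath, hQ⟩ := exists_list_walk (K := K) hP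
    fun l hl e he => (hK e).1 (Multiset.mem_bind.2 ⟨l, hl, he⟩)
  rw [← hQ] at hE hK
  have hdecomp : K.IsPathDecomp Q := by
    refine ⟨hpath, ?_, fun e he => ?_⟩
    · exact (List.nodup_flatMap.1 (Multiset.coe_nodup.1 hE)).2.imp
        fun h e he he' => List.disjoint_left.1 h he he'
    · simpa using (hK e).2 he
  have hcard : Multiset.card (P.bind List.endpoints) = Multiset.card P * 2 := by
    rw [Multiset.card_bind, Multiset.map_congr rfl fun l hl => (by
      simp [hP l hl] : (Multiset.card ∘ List.endpoints) l = 2)]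
    simp
  have hle : K.pathNumber ≤ Q.length := Nat.sInf_le ⟨Q, hdecomp, rfl⟩
  omega

variable {V W : Type*} [Fintype V] [Fintype W] {G F T : SimpleGraph V} {H : SimpleGraph W}
  [DecidableRel H.Adj] {a b c d : V}

lemma mem_prodEdges_iff {E : Multiset (Sym2 V)} (hE : ∀ e, e ∈ E ↔ e ∈ G.edgeSet)
    (f : Sym2 (V × W)) : f ∈ prodEdges H E Finset.univ.val ↔ f ∈ (G □ H).edgeSet := by
  induction f with
  | h x y =>
  obtain ⟨x, h⟩ := x
  obtain ⟨y, k⟩ := y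
  rw [mem_edgeSet, boxProd_adj, prodEdges, Multiset.mem_add, Multiset.mem_bind, Multiset.mem_bind]
  refine or_congr ⟨?_, ?_⟩ ⟨?_, ?_⟩
  · rintro ⟨e, he, hf⟩
    obtain ⟨j, hj⟩ := mem_layerCopies.1 hf
    induction e with
    | h u v =>
    have huv : G.Adj u v := (hE _).1 he
    simp only [Sym2.map_mk, Sym2.eq_iff, Prod.mk.injEq] at hj
    rcases hj with ⟨⟨rfl, rfl⟩, rfl, rfl⟩ | ⟨⟨rfl, rfl⟩, rfl, rfl⟩
    · exact ⟨huv, rfl⟩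
    · exact ⟨huv.symm, rfl⟩
  · rintro ⟨hxy, hhk : h = k⟩
    exact ⟨s(x, y), (hE _).2 hxy, mem_layerCopies.2 ⟨h, by simp [hhk]⟩⟩
  · rintro ⟨v, -, hf⟩
    obtain ⟨e, he, hj⟩ := Multiset.mem_map.1 hf
    induction e with
    | h u w =>
    have huw : H.Adj u w := by simpa using he
    simp only [Sym2.map_mk, Sym2.eq_iff, Prod.mk.injEq] at hj
    rcases hj with ⟨⟨rfl, rfl⟩, rfl, rfl⟩ | ⟨⟨rfl, rfl⟩, rfl, rfl⟩
    · exact ⟨huw, rfl⟩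
    · exact ⟨huw.symm, rfl⟩
  · rintro ⟨hhk, hxy : x = y⟩
    exact ⟨x, Finset.mem_univ x, Multiset.mem_map.2 ⟨s(h, k), by simpa using hhk, by simp [hxy]⟩⟩

open Classical in
lemma IsTile.two_mul_pathNumber_le (h : IsTile H G.edgeFinset.val Finset.univ) :
    2 * (G □ H).pathNumber ≤ Fintype.card V * Fintype.card W := by
  obtain ⟨D, hD, hcard⟩ := h
  refine (hD.two_mul_pathNumber_le (nodup_prodEdges H (Finset.nodup _) ?_ (Finset.nodup _))
    (mem_prodEdges_iff fun e => ?_)).trans hcard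
  · exact fun e he => G.not_isDiag_of_mem_edgeSet (mem_edgeFinset.1 he)
  · rw [Finset.mem_val, mem_edgeFinset]

open Classical in
lemma isTile_univ_of_forall_not_adj (hH : H.Connected) (hG : ∀ v, G.degree v ≠ 0) {P : G.Walk a d}
    (hP : P.IsPath) (had : a ≠ d) (hF : F.IsAcyclic)
    (hs : G.edgeFinset.val = (P.edges : Multiset _) + F.edgeFinset.val)
    (ha : ∀ v ∈ P.support, ¬F.Adj a v) (hd : ∀ v ∈ P.support, ¬F.Adj d v)
    (hx : ∀ x, (∀ v, F.Adj a v ↔ v = x) → (∀ v, F.Adj d v ↔ v = x) → Even (F.degree x) →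
      ∃ y ∉ P.support, F.Adj x y) : IsTile H G.edgeFinset.val Finset.univ := by
  have hodd : ∀ u, Odd (F.degree u) → ∃ y, F.Adj u y := fun u hu =>
    (F.degree_pos_iff_exists_adj u).1 hu.pos
  have hs' : G.edgeFinset.val = (P.reverse.edges : Multiset _) + F.edgeFinset.val := by
    rw [hs, Walk.edges_reverse, Multiset.coe_reverse]
  by_cases hda : Even (F.degree a)
  · refine isTile_univ_of_even_degree hH hG hP.reverse hF hs' (by simp) had hda fun h => ?_
    obtain ⟨y, hy⟩ := hodd d h
    exact ⟨y, by simpa using fun hyP => hd y hyP hy, hy⟩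
  by_cases hdd : Even (F.degree d)
  · refine isTile_univ_of_even_degree hH hG hP hF hs (by simp) had.symm hdd fun h => ?_
    obtain ⟨y, hy⟩ := hodd a h
    exact ⟨y, fun hyP => ha y hyP hy, hy⟩
  rw [Nat.not_even_iff_odd] at hda hdd
  have hkey : ∀ x, F.Adj a x → ∃ K ≤ F, ∃ hxa : G.Adj x a, (Walk.cons hxa P).IsPath ∧
      G.edgeFinset.val = ((Walk.cons hxa P).edges : Multiset _) + K.edgeFinset.val ∧
      Even (K.degree a) ∧ F.degree x = 1 + K.degree x ∧
      ∀ u v, K.Adj u v ↔ F.Adj u v ∧ s(u, v) ≠ s(x, a) := by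
    intro x hax
    obtain ⟨K, hK, hsK⟩ := (show hax.symm.toWalk.IsTrail by simp).exists_edgeFinset_eq_add
    have hdeg := degree_eq_of_edgeFinset_eq_add hsK
    refine ⟨K, hK, ((adj_iff_of_edgeFinset_eq_add hs).1 hax.symm).1,
      hP.cons fun h => ha x h hax, ?_, ?_, ?_, fun u v => ?_⟩
    · rw [hs, hsK, Walk.edges_cons, ← Multiset.cons_coe]
      simp [← Multiset.cons_coe]
    · have := hdeg a
      have h1 : (hax.symm.toWalk.edges : Multiset _).incidence a = 1 := by
        simp [← Multiset.cons_zero, Multiset.incidence_cons_of_mem]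
      grind
    · rw [hdeg]
      congr 1
      simp [← Multiset.cons_zero, Multiset.incidence_cons_of_mem]
    · rw [adj_iff_of_edgeFinset_eq_add hsK]
      simp
  by_cases hxy : ∃ x y, F.Adj a x ∧ F.Adj d y ∧ x ≠ y
  · obtain ⟨x, y, hax, hdy, hne⟩ := hxy
    obtain ⟨K, hK, hxa, hp, hsK, hKa, -, hadj⟩ := hkey x hax
    refine isTile_univ_of_even_degree hH hG hp.reverse (hF.anti hK) ?_ (z := a) (by simp) had hKa
      fun _ => ⟨y, ?_, (hadj d y).2 ⟨hdy, ?_⟩⟩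
    · rw [hsK, Walk.edges_reverse, Multiset.coe_reverse]
    · have hyP : y ∉ P.support := fun hyP => hd y hyP hdy
      have hya : y ≠ a := fun h => hyP (h ▸ P.start_mem_support)
      simp [hyP, hya, hne.symm]
    · rw [Ne, Sym2.eq_iff]
      rintro (⟨rfl, -⟩ | ⟨rfl, -⟩)
      · exact ha d P.end_mem_support hax
      · exact had rfl
  · push Not at hxy
    obtain ⟨x, hax⟩ := hodd a hda
    obtain ⟨x', hdx'⟩ := hodd d hdd
    obtain rfl := hxy x x' hax hdx'
    obtain ⟨K, hK, hxa, hp, hsK, hKa, hKx, hadj⟩ := hkey x hax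
    refine isTile_univ_of_even_degree hH hG hp (hF.anti hK) hsK (z := a) (by simp) hax.ne hKa
      fun h => ?_
    obtain ⟨y, hyP, hxy'⟩ := hx x
      (fun v => ⟨fun hv => hxy v x hv hdx', fun hv => hv ▸ hax⟩)
      (fun v => ⟨fun hv => (hxy x v hax hv).symm, fun hv => hv ▸ hdx'⟩)
      (by rw [hKx]; exact odd_one.add_odd h)
    refine ⟨y, by simp [hxy'.ne', hyP], (hadj x y).2 ⟨hxy', ?_⟩⟩
    rw [Ne, Sym2.congr_right]
    rintro rfl
    exact hyP P.start_mem_support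

namespace SimpleGraph

open Classical in
lemma IsCotreePair.isTile (hH : H.Connected) (hG : ∀ v, G.degree v ≠ 0)
    (h : IsCotreePair G T a b c d) (hT : T.IsAcyclic) (hne : a ≠ d) (had : ¬T.Adj a d)
    {q : T.Walk b c} (hq : q.IsPath) (haq : a ∉ q.support) (hdq : d ∉ q.support)
    (hav : ∀ v ∈ q.support, ¬T.Adj a v) (hdv : ∀ v ∈ q.support, ¬T.Adj d v) :
    IsTile H G.edgeFinset.val Finset.univ := by
  obtain ⟨P, hP⟩ : ∃ P, P = Walk.cons h.adj_left ((q.mapLe h.le).concat h.adj_right) := ⟨_, rfl⟩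
  have hsupp : ∀ v, v ∈ P.support ↔ v = a ∨ v ∈ q.support ∨ v = d := by
    intro v
    simp [hP, Walk.support_concat]
  have hpath : P.IsPath := by
    rw [hP]
    refine (((Walk.isPath_mapLe h.le).2 hq).concat ?_ _).cons ?_
    · simpa [Walk.support_mapLe_eq_support] using hdq
    · simpa [Walk.support_concat, Walk.support_mapLe_eq_support, hne] using haq
  obtain ⟨F, -, hs⟩ := hpath.isTrail.exists_edgeFinset_eq_add
  have hadj : ∀ x y, F.Adj x y ↔ T.Adj x y ∧ s(x, y) ∉ q.edges := by
    intro x y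
    rw [adj_iff_of_edgeFinset_eq_add hs, h.adj_iff]
    simp only [hP, Walk.edges_cons, Walk.edges_concat, Walk.edges_mapLe_eq_edges, List.mem_cons,
      List.concat_eq_append, List.mem_append, List.not_mem_nil, or_false]
    tauto
  have hle : F ≤ T := fun x y hxy => ((hadj x y).1 hxy).1
  have hoff : ∀ x y, x ∉ q.support → T.Adj x y → F.Adj x y := fun x y hx hxy =>
    (hadj x y).2 ⟨hxy, fun he => hx (q.fst_mem_support_of_mem_edges he)⟩
  refine isTile_univ_of_forall_not_adj hH hG hpath hne (hT.anti hle) hs ?_ ?_ ?_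
  · intro v hv hF
    rcases (hsupp v).1 hv with rfl | hv | rfl
    · exact F.loopless.irrefl _ hF
    · exact hav v hv (hle hF)
    · exact had (hle hF)
  · intro v hv hF
    rcases (hsupp v).1 hv with rfl | hv | rfl
    · exact had (hle hF).symm
    · exact hdv v hv (hle hF)
    · exact F.loopless.irrefl _ hF
  · intro x hax hdx heven
    by_contra! hcon
    have hxa : F.Adj x a := ((hax x).2 rfl).symm
    have hxd : F.Adj x d := ((hdx x).2 rfl).symm
    have hxq : x ∉ q.support := fun hx => hav x hx (hle hxa.symm)
    have hnbr : ∀ y, F.Adj x y → y = a ∨ y ∈ q.support ∨ y = d := fun y hy =>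
      (hsupp y).1 (by_contra fun hyP => hcon y hyP hy)
    by_cases hv : ∃ v ∈ q.support, F.Adj x v
    · obtain ⟨v, hvq, hxv⟩ := hv
      have hN : F.neighborFinset x = {a, d, v} := by
        ext y
        simp only [mem_neighborFinset, Finset.mem_insert, Finset.mem_singleton]
        refine ⟨fun hy => ?_, ?_⟩
        · rcases hnbr y hy with hya | hyq | hyd
          · exact .inl hya
          · exact .inr (.inr (hT.eq_of_adj_of_mem_support hxq hyq hvq (hle hy) (hle hxv)))
          · exact .inr (.inl hyd)
        · rintro (rfl | rfl | rfl) <;> assumption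
      have hav' : a ≠ v := fun e => haq (e ▸ hvq)
      have hdv' : d ≠ v := fun e => hdq (e ▸ hvq)
      rw [← card_neighborFinset_eq_degree, hN,
        Finset.card_eq_three.2 ⟨a, d, v, hne, hav', hdv', rfl⟩] at heven
      exact absurd heven (by decide)
    · push Not at hv
      have hclosed : ∀ u w, T.Reachable u w → u = a ∨ u = x ∨ u = d → w = a ∨ w = x ∨ w = d := by
        rintro u w ⟨p⟩
        induction p with
        | nil => exact id
        | @cons u v w huv p ih =>
          refine fun hu => ih ?_
          rcases hu with rfl | rfl | rfl
          · exact .inr (.inl ((hax v).1 (hoff _ _ haq huv)))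
          · have hF := hoff _ _ hxq huv
            rcases hnbr v hF with h1 | h1 | h1
            · exact .inl h1
            · exact absurd hF (hv v h1)
            · exact .inr (.inr h1)
          · exact .inr (.inl ((hdx v).1 (hoff _ _ hdq huv)))
      rcases hclosed a b (h.connected.preconnected a b) (.inl rfl) with rfl | rfl | rfl
      · exact haq q.start_mem_support
      · exact hxq q.start_mem_support
      · exact hdq q.start_mem_support

end SimpleGraph

end Bicyclic

/-- Gallai's conjecture holds for the product of a bicyclic graph with any connected
graph: if `G` is connected with exactly one more edge than vertices, then
`p(G □ H) ≤ mn/2`. -/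
theorem pathNumber_bicyclic_boxProd_le {V W : Type*} [Fintype V] [Fintype W]
    (G : SimpleGraph V) [DecidableRel G.Adj] (H : SimpleGraph W)
    (hG : G.Connected) (hsize : G.edgeFinset.card = Fintype.card V + 1)
    (hH : H.Connected) :
    2 * (G □ H).pathNumber ≤ Fintype.card V * Fintype.card W := by
  classical
  obtain ⟨T, a, b, c, d, h, hT, hne, had, q, hq, ha, hd, hav, hdv⟩ :=
    hG.exists_isCotreePair_not_adj hsize
  have : Nontrivial V := ⟨a, d, hne⟩
  have hdeg : ∀ v, G.degree v ≠ 0 := fun v => (hG.preconnected.degree_pos_of_nontrivial v).ne'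
  refine IsTile.two_mul_pathNumber_le (h.isTile hH (fun v => ?_) hT hne had hq ha hd hav hdv)
  convert hdeg v
end

section
/- Let G be a unicyclic graph of order m ≥ 3 whose unique cycle contains at least two vertices of odd degree in G. Then G admits a path decomposition into exactly n_o(G)/2 paths, i.e., p(G) = n_o(G)/2. -/
open SimpleGraph

/-- `n_o(G)`: the number of vertices of `G` of odd degree. -/
def SimpleGraph.oddCount {V : Type*} [Fintype V] (G : SimpleGraph V)
    [DecidableRel G.Adj] : ℕ :=
  (Finset.univ.filter fun v => Odd (G.degree v)).card

namespace SimpleGraph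

variable {V : Type*} {G : SimpleGraph V}

lemma card_filter_mem_toFinset [DecidableEq V] {l : List (Sym2 V)} (hl : l.Nodup) (x : V) :
    (l.toFinset.filter (x ∈ ·)).card = l.countP (x ∈ ·) := by
  rw [List.countP_eq_length_filter, ← List.toFinset_card_of_nodup (hl.filter _),
    List.toFinset_filter]
  simp

lemma degree_eq_card_filter_edgeFinset [Fintype V] [DecidableEq V] [DecidableRel G.Adj] (x : V) :
    G.degree x = (G.edgeFinset.filter (x ∈ ·)).card := by
  rw [← card_incidenceFinset_eq_degree, incidenceFinset_eq_filter]

lemma degree_deleteEdges_add_countP [Fintype V] [DecidableEq V] [DecidableRel G.Adj]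
    {u v : V} {p : G.Walk u v} (hp : p.IsTrail)
    [DecidableRel (G.deleteEdges {e | e ∈ p.edges}).Adj] (x : V) :
    (G.deleteEdges {e | e ∈ p.edges}).degree x + p.edges.countP (x ∈ ·) = G.degree x := by
  have hE : G.edgeFinset =
      (G.deleteEdges {e | e ∈ p.edges}).edgeFinset ∪ p.edges.toFinset := by
    ext e
    have := p.edges_subset_edgeSet (e := e)
    simp only [mem_edgeFinset, Finset.mem_union, edgeSet_deleteEdges, Set.mem_sdiff,
      Set.mem_ofPred_eq, List.mem_toFinset]
    tauto
  have hdisj : Disjoint (G.deleteEdges {e | e ∈ p.edges}).edgeFinset p.edges.toFinset := by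
    rw [Finset.disjoint_left]
    intro e he
    simp only [mem_edgeFinset, edgeSet_deleteEdges, Set.mem_sdiff, Set.mem_ofPred_eq] at he
    simpa using he.2
  rw [degree_eq_card_filter_edgeFinset, degree_eq_card_filter_edgeFinset,
    ← card_filter_mem_toFinset hp.edges_nodup, hE, Finset.filter_union,
    Finset.card_union_of_disjoint (Finset.disjoint_filter_filter hdisj)]

/-- Deleting the edges of a path between two odd vertices makes exactly those two even. -/
lemma oddCount_deleteEdges_add_two [Fintype V] [DecidableRel G.Adj]
    {u v : V} {p : G.Walk u v} (hp : p.IsTrail) (huv : u ≠ v)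
    (hu : Odd (G.degree u)) (hv : Odd (G.degree v))
    [DecidableRel (G.deleteEdges {e | e ∈ p.edges}).Adj] :
    (G.deleteEdges {e | e ∈ p.edges}).oddCount + 2 = G.oddCount := by
  classical
  have hodd (x : V) : Odd ((G.deleteEdges {e | e ∈ p.edges}).degree x) ↔
      Odd (G.degree x) ∧ x ≠ u ∧ x ≠ v := by
    have hdeg := degree_deleteEdges_add_countP hp x
    have heven := hp.even_countP_edges_iff x
    rw [← hdeg, Nat.odd_add, heven]
    by_cases h : x = u ∨ x = v
    · have hx : Odd (G.degree x) := by rcases h with rfl | rfl <;> assumption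
      rw [← hdeg, Nat.odd_add, heven] at hx
      tauto
    · tauto
  have hset : Finset.univ.filter (fun x => Odd ((G.deleteEdges {e | e ∈ p.edges}).degree x)) =
      (Finset.univ.filter fun x => Odd (G.degree x)) \ {u, v} := by
    ext x
    simp [hodd]
  have hsub : {u, v} ⊆ Finset.univ.filter fun x => Odd (G.degree x) := by
    simp [Finset.insert_subset_iff, hu, hv]
  have hle := Finset.card_le_card hsub
  rw [Finset.card_pair huv] at hle
  rw [oddCount, oddCount, hset, Finset.card_sdiff_of_subset hsub, Finset.card_pair huv]
  omega

lemma IsPathDecomp.cons {u v : V} {p : G.Walk u v} (hp : p.IsPath)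
    {P : List (Σ u v : V, (G.deleteEdges {e | e ∈ p.edges}).Walk u v)}
    (hP : (G.deleteEdges {e | e ∈ p.edges}).IsPathDecomp P) :
    G.IsPathDecomp (⟨u, v, p⟩ :: P.map fun q => ⟨q.1, q.2.1, q.2.2.mapLe (deleteEdges_le _)⟩) := by
  obtain ⟨hpath, hdisj, hcover⟩ := hP
  refine ⟨?_, ?_, ?_⟩
  · simp only [List.mem_cons, List.mem_map, forall_eq_or_imp, forall_exists_index, and_imp,
      forall_apply_eq_imp_iff₂]
    exact ⟨hp, fun q hq => (Walk.isPath_mapLe _).2 (hpath q hq)⟩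
  · simp only [List.pairwise_cons, List.mem_map, forall_exists_index, and_imp,
      forall_apply_eq_imp_iff₂, List.pairwise_map, Walk.edges_mapLe_eq_edges]
    refine ⟨fun q _ e he heq => ?_, hdisj⟩
    have := q.2.2.edges_subset_edgeSet heq
    rw [edgeSet_deleteEdges] at this
    exact this.2 he
  · intro e he
    by_cases hep : e ∈ p.edges
    · exact ⟨⟨u, v, p⟩, by simp, hep⟩
    · obtain ⟨q, hq, heq⟩ := hcover e (by rw [edgeSet_deleteEdges]; exact ⟨he, hep⟩)
      exact ⟨_, List.mem_cons_of_mem _ (List.mem_map_of_mem hq), by simpa using heq⟩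

lemma IsAcyclic.exists_isPath_degree_eq_one [Finite V] [G.LocallyFinite] (h : G.IsAcyclic)
    (hne : G ≠ ⊥) : ∃ (u v : V) (p : G.Walk u v),
      p.IsPath ∧ u ≠ v ∧ G.degree u = 1 ∧ G.degree v = 1 := by
  obtain ⟨a, b, hab⟩ := ne_bot_iff_exists_adj.1 hne
  have : Nonempty V := ⟨a⟩
  obtain ⟨u, v, p, hp, hmax⟩ := Walk.exists_isPath_forall_isPath_length_le_length G
  have hnil : ¬p.Nil := by
    have hlen := hmax a b hab.toWalk (Walk.IsPath.of_adj hab)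
    grind [Walk.length_cons]
  refine ⟨u, v, p, hp, hp.nil_iff_eq.not.mp hnil, ?_, ?_⟩ <;>
    rw [degree_eq_one_iff_existsUnique_adj]
  · refine ⟨_, p.adj_snd hnil, fun w hadj ↦ h.eq_snd_of_adj_start hp hadj ?_⟩
    have : ¬(p.cons hadj.symm).IsPath := by grind [Walk.length_cons]
    grind [hp.cons]
  · refine ⟨_, p.adj_penultimate hnil |>.symm, fun w hadj ↦ h.eq_penultimate_of_adj_end hp hadj ?_⟩
    have : ¬(p.concat hadj).IsPath := by grind [Walk.length_concat]
    grind [hp.concat]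

lemma IsAcyclic.exists_isPathDecomp [Fintype V] [DecidableRel G.Adj] (h : G.IsAcyclic) :
    ∃ P, G.IsPathDecomp P ∧ 2 * P.length = G.oddCount := by
  classical
  induction hn : G.oddCount using Nat.strong_induction_on generalizing G with
  | _ n ih =>
    by_cases hne : G = ⊥
    · subst hne
      refine ⟨[], ⟨by simp, by simp, by simp⟩, ?_⟩
      simp [← hn, oddCount]
    · obtain ⟨u, v, p, hp, huv, hu, hv⟩ := h.exists_isPath_degree_eq_one hne
      have hcount := oddCount_deleteEdges_add_two hp.isTrail huv
        (hu ▸ odd_one) (hv ▸ odd_one)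
      obtain ⟨P, hP, hlen⟩ := ih (G := G.deleteEdges {e | e ∈ p.edges}) _ (by omega)
        (h.anti (deleteEdges_le _)) rfl
      exact ⟨_, hP.cons hp, by simp only [List.length_cons, List.length_map]; omega⟩

/-- Every odd vertex is an end of some path of a path decomposition. -/
lemma IsPathDecomp.oddCount_le [Fintype V] [DecidableRel G.Adj]
    {P : List (Σ u v : V, G.Walk u v)} (hP : G.IsPathDecomp P) :
    G.oddCount ≤ 2 * P.length := by
  classical
  obtain ⟨hpath, hdisj, hcover⟩ := hP
  have hnodup : (P.flatMap fun p => p.2.2.edges).Nodup :=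
    List.nodup_flatMap.2 ⟨fun p hp => (hpath p hp).isTrail.edges_nodup, hdisj⟩
  have hedges : G.edgeFinset = (P.flatMap fun p => p.2.2.edges).toFinset := by
    ext e
    simp only [mem_edgeFinset, List.mem_toFinset, List.mem_flatMap]
    exact ⟨hcover e, fun ⟨p, _, he⟩ => p.2.2.edges_subset_edgeSet he⟩
  have hsub : (Finset.univ.filter fun x => Odd (G.degree x)) ⊆
      (P.map fun p => p.1).toFinset ∪ (P.map fun p => p.2.1).toFinset := by
    intro x hx
    by_contra hend
    simp only [Finset.mem_union, List.mem_toFinset, List.mem_map, not_or, not_exists,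
      not_and] at hend
    refine Nat.not_odd_iff_even.2 ?_ (Finset.mem_filter.1 hx).2
    rw [degree_eq_card_filter_edgeFinset, hedges, card_filter_mem_toFinset hnodup,
      List.countP_flatMap, even_iff_two_dvd]
    refine List.dvd_sum fun n hn => ?_
    obtain ⟨p, hp, rfl⟩ := List.mem_map.1 hn
    exact even_iff_two_dvd.1 (((hpath p hp).isTrail.even_countP_edges_iff x).2
      fun _ => ⟨Ne.symm (hend.1 p hp), Ne.symm (hend.2 p hp)⟩)
  calc G.oddCount ≤ _ := Finset.card_le_card hsub
    _ ≤ _ := Finset.card_union_le _ _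
    _ ≤ P.length + P.length := by
      gcongr <;> exact (List.toFinset_card_le _).trans_eq (List.length_map _)
    _ = 2 * P.length := (two_mul _).symm

/-- A path decomposition with half as many paths as there are odd vertices is minimum. -/
lemma IsPathDecomp.two_mul_pathNumber [Fintype V] [DecidableRel G.Adj]
    {P : List (Σ u v : V, G.Walk u v)} (hP : G.IsPathDecomp P)
    (hlen : 2 * P.length = G.oddCount) : 2 * G.pathNumber = G.oddCount := by
  have hle : G.pathNumber ≤ P.length := Nat.sInf_le ⟨P, hP, rfl⟩
  obtain ⟨Q, hQ, hQlen⟩ : G.pathNumber ∈ {k | ∃ P, G.IsPathDecomp P ∧ P.length = k} :=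
    Nat.sInf_mem ⟨_, P, hP, rfl⟩
  have := hQ.oddCount_le
  omega

lemma Connected.isTree_deleteEdges_of_mem_cycle [Finite V] (hG : G.Connected)
    (hsize : Nat.card G.edgeSet = Nat.card V) {u : V} {c : G.Walk u u} (hc : c.IsCycle)
    {e : Sym2 V} (he : e ∈ c.edges) : (G.deleteEdges {e}).IsTree := by
  have hbridge : ¬G.IsBridge e := fun h => h.notMem_edges_of_isCycle hc he
  have heG : e ∈ G.edgeSet := c.edges_subset_edgeSet he
  rw [isTree_iff_connected_and_card]
  refine ⟨?_, ?_⟩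
  · induction e with
    | h x y => exact hG.connected_delete_edge_of_not_isBridge hbridge
  · rw [edgeSet_deleteEdges, Nat.card_coe_set_eq,
      Set.ncard_sdiff_singleton_add_one heG, ← hsize, Nat.card_coe_set_eq]

end SimpleGraph

/-- If `G` is a unicyclic graph of order `m ≥ 3` whose (unique) cycle contains at least
two vertices of odd degree, then `p(G) = n_o(G)/2`. -/
theorem pathNumber_unicyclic_eq {V : Type*} [Fintype V] [DecidableEq V]
    (G : SimpleGraph V) [DecidableRel G.Adj]
    (hG : G.Connected) (hm : 3 ≤ Fintype.card V)
    (hsize : G.edgeFinset.card = Fintype.card V)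
    (hcyc : ∃ (u : V) (c : G.Walk u u), c.IsCycle ∧
      2 ≤ (Finset.univ.filter fun v => Odd (G.degree v) ∧ v ∈ c.support).card) :
    2 * G.pathNumber = G.oddCount := by
  obtain ⟨a, c, hc, hodd⟩ := hcyc
  obtain ⟨x, hx, y, hy, hxy⟩ := Finset.one_lt_card.1 hodd
  obtain ⟨hxodd, hxc⟩ := (Finset.mem_filter.1 hx).2
  obtain ⟨hyodd, hyc⟩ := (Finset.mem_filter.1 hy).2
  have hc' := hc.rotate hxc
  have hyc' : y ∈ (c.rotate x hxc).support := (c.mem_support_rotate_iff x hxc).2 hyc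
  let p := (c.rotate x hxc).takeUntil y hyc'
  have hp : p.IsPath := hc'.isPath_takeUntil hyc'
  obtain ⟨e, he⟩ : ∃ e, e ∈ p.edges :=
    List.exists_mem_of_ne_nil _ fun h => hxy (Walk.edges_eq_nil.1 h).eq
  have htree := hG.isTree_deleteEdges_of_mem_cycle
    (by simpa [edgeFinset_card] using hsize) hc'
    (Walk.edges_takeUntil_subset_edges _ hyc' he)
  have hacyc : (G.deleteEdges {e | e ∈ p.edges}).IsAcyclic :=
    htree.isAcyclic.anti (deleteEdges_anti (by simpa using he))
  classical
  obtain ⟨P, hP, hlen⟩ := hacyc.exists_isPathDecomp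
  have hcount := oddCount_deleteEdges_add_two hp.isTrail hxy hxodd hyodd
  exact (hP.cons hp).two_mul_pathNumber
    (by simp only [List.length_cons, List.length_map]; omega)
end

section
/- Let P₂ denote the single edge (path on two vertices), let m ≥ 5, and let G be the graph obtained from the path P_m = u₁u₂⋯u_m by adding the two edges u₁u₄ and u₂u₅. Then p(G □ P₂) ≤ m, i.e., the cartesian product of G with a single edge decomposes into at most m edge-disjoint paths. -/
open SimpleGraph

/-- The path `u₁⋯u_m` together with the edges `u₁u₄` and `u₂u₅`. -/
abbrev familyB (m : ℕ) (hm : 5 ≤ m) : SimpleGraph (Fin m) :=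
  pathGraph m ⊔ fromEdgeSet
    {s(Fin.castLE hm 0, Fin.castLE hm 3), s(Fin.castLE hm 1, Fin.castLE hm 4)}

theorem familyB_adj {m : ℕ} (hm : 5 ≤ m) (a b : Fin m) :
    (familyB m hm).Adj a b ↔ a.val + 1 = b.val ∨ b.val + 1 = a.val ∨
      (a.val = 0 ∧ b.val = 3) ∨ (a.val = 3 ∧ b.val = 0) ∨
      (a.val = 1 ∧ b.val = 4) ∨ (a.val = 4 ∧ b.val = 1) := by
  simp only [familyB, sup_adj, pathGraph_adj, fromEdgeSet_adj, Set.mem_insert_iff,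
    Set.mem_singleton_iff, Sym2.eq_iff, Fin.ext_iff,
    Fin.val_castLE, Fin.coe_ofNat_eq_mod, ne_eq]
  omega

theorem familyB_boxProd_adj {m : ℕ} (hm : 5 ≤ m) (x y : Fin m × Fin 2) :
    (familyB m hm □ pathGraph 2).Adj x y ↔
      (x.1.val + 1 = y.1.val ∨ y.1.val + 1 = x.1.val ∨
        (x.1.val = 0 ∧ y.1.val = 3) ∨ (x.1.val = 3 ∧ y.1.val = 0) ∨
        (x.1.val = 1 ∧ y.1.val = 4) ∨ (x.1.val = 4 ∧ y.1.val = 1)) ∧ x.2 = y.2 ∨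
      x.2 ≠ y.2 ∧ x.1 = y.1 := by
  rw [boxProd_adj, familyB_adj, pathGraph_adj]
  have : (x.2.val + 1 = y.2.val ∨ y.2.val + 1 = x.2.val) ↔ x.2 ≠ y.2 := by
    rw [ne_eq, Fin.ext_iff]; omega
  rw [this]

instance {m : ℕ} (hm : 5 ≤ m) : DecidableRel (familyB m hm □ pathGraph 2).Adj :=
  fun x y => decidable_of_iff' _ (familyB_boxProd_adj hm x y)

/-- An injective homomorphism transports a path decomposition; adding one further path that
avoids the image and covers the remaining edges decomposes the target. -/
theorem SimpleGraph.IsPathDecomp.map_cons {V W : Type*} {G : SimpleGraph V} {H : SimpleGraph W}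
    {P : List (Σ u v : V, G.Walk u v)} (hP : G.IsPathDecomp P) (f : G →g H)
    (hf : Function.Injective f) {u v : W} {q : H.Walk u v} (hq : q.IsPath)
    (hdisj : ∀ e ∈ q.edges, ∀ e' ∈ G.edgeSet, e ≠ Sym2.map f e')
    (hcov : ∀ e ∈ H.edgeSet, e ∈ q.edges ∨ ∃ e' ∈ G.edgeSet, Sym2.map f e' = e) :
    H.IsPathDecomp (⟨u, v, q⟩ :: P.map fun p => ⟨f p.1, f p.2.1, p.2.2.map f⟩) := by
  obtain ⟨hpath, hpair, hall⟩ := hP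
  refine ⟨?_, ?_, ?_⟩
  · simp only [List.mem_cons, List.mem_map]
    rintro _ (rfl | ⟨p, hp, rfl⟩)
    · exact hq
    · exact (hpath p hp).map hf
  · rw [List.pairwise_cons]
    constructor
    · simp only [List.mem_map]
      rintro _ ⟨p, -, rfl⟩ e he he'
      simp only [Walk.edges_map, List.mem_map] at he'
      obtain ⟨e', he', rfl⟩ := he'
      exact hdisj _ he _ (p.2.2.edges_subset_edgeSet he') rfl
    · rw [List.pairwise_map]
      refine hpair.imp fun {a b} h e he he' => ?_
      simp only [Walk.edges_map, List.mem_map] at he he'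
      obtain ⟨e₁, h₁, rfl⟩ := he
      obtain ⟨e₂, h₂, heq⟩ := he'
      obtain rfl := Sym2.map.injective hf heq
      exact h _ h₁ h₂
  · intro e he
    rcases hcov e he with h | ⟨e', he', rfl⟩
    · exact ⟨_, List.mem_cons_self, h⟩
    · obtain ⟨p, hp, hep⟩ := hall e' he'
      refine ⟨_, List.mem_cons_of_mem _ (List.mem_map_of_mem hp), ?_⟩
      simpa only [Walk.edges_map] using List.mem_map_of_mem hep

theorem exists_isPathDecomp_familyB_five :
    ∃ P, (familyB 5 le_rfl □ pathGraph 2).IsPathDecomp P ∧ P.length = 5 := by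
  let G := familyB 5 le_rfl □ pathGraph 2
  let p₁ : G.Walk (0, 0) (0, 1) :=
    .cons (v := (1, 0)) (by decide) <| .cons (v := (2, 0)) (by decide) <|
    .cons (v := (3, 0)) (by decide) <| .cons (v := (4, 0)) (by decide) <|
    .cons (v := (4, 1)) (by decide) <| .cons (v := (3, 1)) (by decide) <|
    .cons (v := (2, 1)) (by decide) <| .cons (v := (1, 1)) (by decide) <|
    .cons (by decide) .nil
  let p₂ : G.Walk (4, 0) (4, 1) :=
    .cons (v := (1, 0)) (by decide) <| .cons (v := (1, 1)) (by decide) <|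
    .cons (by decide) .nil
  let p₃ : G.Walk (3, 0) (3, 1) :=
    .cons (v := (0, 0)) (by decide) <| .cons (v := (0, 1)) (by decide) <|
    .cons (by decide) .nil
  let p₄ : G.Walk (3, 0) (3, 1) := .cons (by decide) .nil
  let p₅ : G.Walk (2, 0) (2, 1) := .cons (by decide) .nil
  refine ⟨[⟨_, _, p₁⟩, ⟨_, _, p₂⟩, ⟨_, _, p₃⟩, ⟨_, _, p₄⟩, ⟨_, _, p₅⟩], ⟨?_, ?_, ?_⟩, rfl⟩
  · simp only [List.forall_mem_cons, Walk.isPath_def]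
    refine ⟨?_, ?_, ?_, ?_, ?_, by simp⟩ <;> decide
  · simp only [List.pairwise_cons, List.forall_mem_cons]
    refine ⟨⟨?_, ?_, ?_, ?_, by simp⟩, ⟨?_, ?_, ?_, by simp⟩, ⟨?_, ?_, by simp⟩,
      ⟨?_, by simp⟩, by simp, by simp⟩ <;> decide
  · have key : ∀ x y : Fin 5 × Fin 2, G.Adj x y → s(x, y) ∈ p₁.edges ∨ s(x, y) ∈ p₂.edges ∨
        s(x, y) ∈ p₃.edges ∨ s(x, y) ∈ p₄.edges ∨ s(x, y) ∈ p₅.edges := by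
      decide
    intro e
    induction e with | _ x y
    intro he
    simpa only [List.mem_cons, List.not_mem_nil, exists_eq_or_imp, or_false, exists_eq_left,
      false_and, exists_false] using key x y he

theorem exists_isPathDecomp_familyB (m : ℕ) (hm : 5 ≤ m) :
    ∃ P, (familyB m hm □ pathGraph 2).IsPathDecomp P ∧ P.length = m := by
  induction m, hm using Nat.le_induction with
  | base => exact exists_isPathDecomp_familyB_five
  | succ m hm ih =>
    obtain ⟨P, hP, hlen⟩ := ih
    let H := familyB (m + 1) (by omega) □ pathGraph 2
    let f : (familyB m hm □ pathGraph 2 : SimpleGraph (Fin m × Fin 2)) →g H :=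
      { toFun := Prod.map Fin.castSucc id
        map_rel' := by
          intro x y h
          rw [familyB_boxProd_adj] at h ⊢
          simpa using h }
    let k : Fin (m + 1) := ⟨m - 1, by omega⟩
    have hk : k.val + 1 = m := Nat.sub_add_cancel (by omega)
    have h₁ : H.Adj (k, 0) (Fin.last m, 0) := by
      rw [familyB_boxProd_adj]; exact .inl ⟨.inl hk, rfl⟩
    have h₂ : H.Adj (Fin.last m, 0) (Fin.last m, 1) := by
      rw [familyB_boxProd_adj]; exact .inr ⟨Fin.zero_ne_one, rfl⟩
    have h₃ : H.Adj (Fin.last m, 1) (k, 1) := by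
      rw [familyB_boxProd_adj]; exact .inl ⟨.inr (.inl hk), rfl⟩
    let q : H.Walk (k, 0) (k, 1) := .cons h₁ (.cons h₂ (.cons h₃ .nil))
    have hkl : k ≠ Fin.last m := fun h => by simp [h] at hk
    have hq : q.IsPath := by simp [q, hkl, hkl.symm]
    have hedges : q.edges = [s((k, 0), (Fin.last m, 0)), s((Fin.last m, 0), (Fin.last m, 1)),
      s((Fin.last m, 1), (k, 1))] := rfl
    have hf : ∀ x, f x = (x.1.castSucc, x.2) := fun _ => rfl
    refine ⟨_, hP.map_cons f ((Fin.castSucc_injective m).prodMap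
      Function.injective_id) hq ?_ ?_, by simp [hlen]⟩
    · rintro e he ⟨x, y⟩ - rfl
      have hx := x.1.castSucc_ne_last
      have hy := y.1.castSucc_ne_last
      rw [hedges] at he
      simp [hf, hx, hy] at he
    · intro e
      induction e with | _ x y
      obtain ⟨a, i⟩ := x
      obtain ⟨b, j⟩ := y
      intro he
      rw [mem_edgeSet, familyB_boxProd_adj] at he
      rw [hedges]
      cases a using Fin.lastCases <;> cases b using Fin.lastCases
      · left
        have hij : i ≠ j := by
          simp only [Fin.val_last] at he
          omega
        fin_cases i <;> fin_cases j <;> simp_all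
      · rename_i b
        left
        have hb : b.castSucc = k := by
          have := b.isLt
          simp only [Fin.ext_iff, Fin.val_last, Fin.val_castSucc] at he ⊢
          omega
        rw [hb] at he ⊢
        fin_cases i <;> fin_cases j <;> simp_all
      · rename_i a
        left
        have ha : a.castSucc = k := by
          have := a.isLt
          simp only [Fin.ext_iff, Fin.val_last, Fin.val_castSucc] at he ⊢
          omega
        rw [ha] at he ⊢
        fin_cases i <;> fin_cases j <;> simp_all
      · rename_i a b
        right
        refine ⟨s((a, i), (b, j)), ?_, rfl⟩
        rw [mem_edgeSet, familyB_boxProd_adj]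
        simpa using he

/-- For `G` the path `u₁⋯u_m` plus the edges `u₁u₄` and `u₂u₅` (`m ≥ 5`),
`p(G □ P₂) ≤ m`. -/
theorem pathNumber_familyB_boxProd_P2_le (m : ℕ) (hm : 5 ≤ m) :
    ((pathGraph m ⊔ fromEdgeSet
        {s((⟨0, by omega⟩ : Fin m), (⟨3, by omega⟩ : Fin m)),
         s((⟨1, by omega⟩ : Fin m), (⟨4, by omega⟩ : Fin m))}) □ pathGraph 2).pathNumber
      ≤ m :=
  Nat.sInf_le (exists_isPathDecomp_familyB m hm)
end
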